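/- arXiv:2310.05602 — 6 statements merged into one kernel-verified Lean document; each statement's English description precedes it below -/
import Mathlib

section
/- Let Λ ⊆ V be finite and nonempty with connected induced subgraph, and let q : Λ → ℝ. Then there exists a function φ : V → ℝ with φ = 0 on V ∖ Λ, ⟨φ,φ⟩ = 1, φ(x) > 0 for every x ∈ Λ, and (Δφ)(x) + q(x)φ(x) = λ_Λ(q;G)·φ(x) for every x ∈ Λ; i.e. the principal Dirichlet eigenvalue on a finite connected set is attained by a strictly positive eigenfunction. -/
open scoped ENNReal BigOperators

/-- degree of a vertex (cardinality of the neighbour set) -/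
noncomputable def degR {V : Type*} (G : SimpleGraph V) (x : V) : ℝ :=
  ((G.neighborSet x).ncard : ℝ)

/-- normalised Laplacian -/
noncomputable def lapl {V : Type*} (G : SimpleGraph V) (f : V → ℝ) (x : V) : ℝ :=
  (1 / degR G x) * ∑ᶠ y ∈ G.neighborSet x, (f y - f x)

/-- degree-weighted inner product -/
noncomputable def dInner {V : Type*} (G : SimpleGraph V) (φ ψ : V → ℝ) : ℝ :=
  ∑ᶠ x, degR G x * φ x * ψ x

/-- principal Dirichlet eigenvalue of `Δ + q` on the finite set `Λ`,
via the Rayleigh–Ritz formula -/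
noncomputable def pev {V : Type*} (G : SimpleGraph V) (Λ : Finset V) (q : V → ℝ) : ℝ :=
  sSup { r | ∃ φ : V → ℝ, (∀ x ∉ Λ, φ x = 0) ∧ dInner G φ φ = 1 ∧
    r = ∑ x ∈ Λ, degR G x * (lapl G φ x + q x * φ x) * φ x }

open scoped Classical in
/-- Perron–Frobenius for the weighted Rayleigh quotient of a symmetric real matrix with nonnegative
off-diagonal entries, positive along the edges of a preconnected graph `H`: the maximum is attained
at a strictly positive vector solving the generalised eigenvalue equation. -/
theorem exists_pos_rayleigh_maximizer {ι : Type*} [Fintype ι] [Nonempty ι]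
    (A : ι → ι → ℝ) (d : ι → ℝ) (hd : ∀ i, 0 < d i) (hsymm : ∀ i j, A i j = A j i)
    (hnonneg : ∀ i j, i ≠ j → 0 ≤ A i j)
    (H : SimpleGraph ι) (hH : H.Preconnected) (hpos : ∀ i j, H.Adj i j → 0 < A i j) :
    ∃ (u : ι → ℝ) (M : ℝ), (∀ i, 0 < u i) ∧ ∑ i, d i * u i * u i = 1 ∧
      (∀ i, ∑ j, A i j * u j = M * (d i * u i)) ∧
      ∀ v : ι → ℝ, ∑ i, d i * v i * v i = 1 → ∑ i, (∑ j, A i j * v j) * v i ≤ M := by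
  set Q : (ι → ℝ) → ℝ := fun v => ∑ i, (∑ j, A i j * v j) * v i with hQ
  set N : (ι → ℝ) → ℝ := fun v => ∑ i, d i * v i * v i with hN
  have hNterm : ∀ (v : ι → ℝ) i, 0 ≤ d i * v i * v i := fun v i => by
    rw [mul_assoc]; exact mul_nonneg (hd i).le (mul_self_nonneg _)
  have hQc : Continuous Q := by fun_prop
  have hNc : Continuous N := by fun_prop
  have hcompact : IsCompact {v | N v = 1} := by
    refine (isCompact_univ_pi fun i => isCompact_Icc
      (a := -(1 + 1 / d i)) (b := 1 + 1 / d i)).of_isClosed_subset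
      (isClosed_eq hNc continuous_const) fun v hv i _ => ?_
    have h1 : d i * v i * v i ≤ 1 := by
      rw [← show N v = 1 from hv]
      exact Finset.single_le_sum (f := fun i => d i * v i * v i)
        (fun j _ => hNterm v j) (Finset.mem_univ i)
    have h2 : v i ^ 2 ≤ 1 / d i := by
      rw [le_div_iff₀ (hd i)]; linarith
    have h3 : 0 < 1 / d i := one_div_pos.2 (hd i)
    exact abs_le.1 (abs_le_of_sq_le_sq (by nlinarith) (by linarith))
  have hsmul : ∀ (c : ℝ) (v : ι → ℝ), N (c • v) = c ^ 2 * N v ∧ Q (c • v) = c ^ 2 * Q v := by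
    intro c v
    simp only [hN, hQ, Pi.smul_apply, smul_eq_mul, Finset.mul_sum, Finset.sum_mul]
    constructor
    · exact Finset.sum_congr rfl fun _ _ => by ring
    · exact Finset.sum_congr rfl fun _ _ => Finset.sum_congr rfl fun _ _ => by ring
  have hNpos : ∀ v : ι → ℝ, v ≠ 0 → 0 < N v := by
    intro v hv
    obtain ⟨i, hi⟩ := Function.ne_iff.1 hv
    refine Finset.sum_pos' (fun j _ => hNterm v j) ⟨i, Finset.mem_univ i, ?_⟩
    rw [mul_assoc]
    exact mul_pos (hd i) (mul_self_pos.2 hi)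
  have hnormalize : ∀ v : ι → ℝ, v ≠ 0 → N ((√(N v))⁻¹ • v) = 1 := by
    intro v hv
    rw [(hsmul _ _).1, inv_pow, Real.sq_sqrt (hNpos v hv).le, inv_mul_cancel₀ (hNpos v hv).ne']
  obtain ⟨v, hv, hmax⟩ := hcompact.exists_isMaxOn
    ⟨_, hnormalize (fun _ => 1) fun h => one_ne_zero (congrFun h (Classical.arbitrary ι))⟩
    hQc.continuousOn
  have hle : ∀ w, Q w ≤ Q v * N w := by
    intro w
    rcases eq_or_ne w 0 with rfl | hw
    · simp [hQ, hN]
    · have h := hmax (hnormalize w hw)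
      change Q _ ≤ Q v at h
      rw [(hsmul _ _).2, inv_pow, Real.sq_sqrt (hNpos w hw).le,
        inv_mul_le_iff₀ (hNpos w hw)] at h
      linarith
  set u : ι → ℝ := fun i => |v i| with hu
  have hNu : N u = 1 := by
    rw [← show N v = 1 from hv]
    simp only [hN, hu, mul_assoc, abs_mul_abs_self]
  have hQu : Q u = Q v := by
    refine le_antisymm (by simpa [hNu] using hle u) ?_
    simp only [hQ, hu, Finset.sum_mul]
    refine Finset.sum_le_sum fun i _ => Finset.sum_le_sum fun j _ => ?_
    rcases eq_or_ne i j with rfl | hij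
    · simp only [mul_assoc, abs_mul_abs_self, le_refl]
    · rw [mul_assoc, mul_assoc, ← abs_mul]
      exact mul_le_mul_of_nonneg_left (le_abs_self _) (hnonneg i j hij)
  let B : Matrix ι ι ℝ := Q v • Matrix.diagonal d - Matrix.of A
  have hBmul : ∀ w i, (B.mulVec w) i = Q v * (d i * w i) - ∑ j, A i j * w j := by
    intro w i
    simp only [B, Matrix.sub_mulVec, Matrix.smul_mulVec, Pi.sub_apply, Pi.smul_apply,
      Matrix.mulVec_diagonal, smul_eq_mul]
    rfl
  have hBquad : ∀ w : ι → ℝ, star w ⬝ᵥ B.mulVec w = Q v * N w - Q w := by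
    intro w
    simp only [dotProduct, hBmul, hN, hQ, Finset.mul_sum, ← Finset.sum_sub_distrib,
      star_trivial]
    exact Finset.sum_congr rfl fun _ _ => by ring
  have hBpsd : B.PosSemidef := by
    refine .of_dotProduct_mulVec_nonneg ?_ fun w => ?_
    · ext i j
      simp only [B, Matrix.conjTranspose_apply, Matrix.sub_apply, Matrix.smul_apply,
        Matrix.of_apply, star_trivial, hsymm j i, Matrix.diagonal_apply, eq_comm (a := j)]
      rcases eq_or_ne i j with rfl | hij
      · rfl
      · simp [hij]
    · rw [hBquad]; linarith [hle w]
  have heig : ∀ i, ∑ j, A i j * u j = Q v * (d i * u i) := by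
    have h0 := (hBpsd.dotProduct_mulVec_zero_iff u).1 (by rw [hBquad, hNu, hQu]; ring)
    intro i
    have := congrFun h0 i
    rw [hBmul, Pi.zero_apply] at this
    linarith
  have hstep : ∀ i j, H.Adj i j → u i = 0 → u j = 0 := by
    intro i j hij hi
    have hnn : ∀ k ∈ Finset.univ, 0 ≤ A i k * u k := by
      intro k _
      rcases eq_or_ne i k with rfl | hik
      · simp [hi]
      · exact mul_nonneg (hnonneg i k hik) (abs_nonneg _)
    have h0 := (Finset.sum_eq_zero_iff_of_nonneg hnn).1 (by rw [heig, hi]; ring) j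
      (Finset.mem_univ j)
    exact (mul_eq_zero.1 h0).resolve_left (hpos i j hij).ne'
  refine ⟨u, Q v, fun i => (abs_nonneg (v i)).lt_of_ne' fun hi => ?_, hNu, heig, fun w hw => ?_⟩
  · have hzero : u = 0 := by
      funext j
      have hij := (SimpleGraph.reachable_iff_reflTransGen i j).1 (hH i j)
      induction hij with
      | refl => exact hi
      | tail _ hadj ih => exact hstep _ _ hadj ih
    rw [hzero] at hNu
    simp [hN] at hNu
  · have := hle w
    rwa [show N w = 1 from hw, mul_one] at this

theorem degR_pos {V : Type*} {G : SimpleGraph V} {x : V} (hfin : (G.neighborSet x).Finite)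
    (hne : (G.neighborSet x).Nonempty) : 0 < degR G x :=
  Nat.cast_pos.2 ((Set.ncard_pos hfin).2 hne)

open scoped Classical in
theorem degR_mul_lapl {V : Type*} {G : SimpleGraph V} {x : V} (hfin : (G.neighborSet x).Finite)
    (hne : (G.neighborSet x).Nonempty) {Λ : Finset V} {φ : V → ℝ} (hφ : ∀ y ∉ Λ, φ y = 0) :
    degR G x * lapl G φ x = ∑ y : Λ, (if G.Adj x y then φ y else 0) - degR G x * φ x := by
  rw [lapl, one_div, mul_inv_cancel_left₀ (degR_pos hfin hne).ne',
    finsum_mem_eq_finite_toFinset_sum _ hfin, Finset.sum_sub_distrib, Finset.sum_const,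
    nsmul_eq_mul, degR, Set.ncard_eq_toFinset_card _ hfin,
    Finset.sum_coe_sort Λ fun y => if G.Adj x y then φ y else 0, ← Finset.sum_filter]
  congr 1
  refine (Finset.sum_subset (fun y hy => ?_) fun y hy hy' => ?_).symm
  · simpa using (Finset.mem_filter.1 hy).2
  · exact hφ y fun hyΛ => hy' (Finset.mem_filter.2 ⟨hyΛ, by simpa using hy⟩)

theorem dInner_self_eq_sum {V : Type*} (G : SimpleGraph V) {Λ : Finset V} {φ : V → ℝ}
    (hφ : ∀ y ∉ Λ, φ y = 0) : dInner G φ φ = ∑ x : Λ, degR G x * φ x * φ x := by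
  rw [Finset.sum_coe_sort Λ fun x => degR G x * φ x * φ x, dInner]
  refine finsum_eq_sum_of_support_subset _ fun x hx => ?_
  by_contra hxΛ
  exact hx (by simp [hφ x hxΛ])

/-- on a finite connected set, the principal Dirichlet eigenvalue is
attained by a strictly positive normalised eigenfunction. -/
theorem principal_eigenfunction_positive {V : Type*} (G : SimpleGraph V)
    (hlf : ∀ x, (G.neighborSet x).Finite)
    (hdeg : ∀ x, (G.neighborSet x).Nonempty)
    (Λ : Finset V) (hΛ : Λ.Nonempty)
    (hconn : (G.induce (↑Λ : Set V)).Connected)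
    (q : V → ℝ) :
    ∃ φ : V → ℝ, (∀ x ∉ Λ, φ x = 0) ∧ dInner G φ φ = 1 ∧
      (∀ x ∈ Λ, 0 < φ x) ∧
      (∀ x ∈ Λ, lapl G φ x + q x * φ x = pev G Λ q * φ x) := by
  classical
  have hne : Nonempty Λ := hΛ.to_subtype
  have hd : ∀ x : Λ, 0 < degR G x := fun x => degR_pos (hlf x) (hdeg x)
  let A : Λ → Λ → ℝ := fun x y =>
    (if G.Adj x y then 1 else 0) + if x = y then degR G x * (q x - 1) else 0
  have hop : ∀ φ : V → ℝ, (∀ x ∉ Λ, φ x = 0) → ∀ x : Λ,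
      degR G x * (lapl G φ x + q x * φ x) = ∑ y : Λ, A x y * φ y := by
    intro φ hφ x
    rw [mul_add, degR_mul_lapl (hlf x) (hdeg x) hφ]
    simp only [A, add_mul, Finset.sum_add_distrib, ite_mul, one_mul, zero_mul,
      Finset.sum_ite_eq, Finset.mem_univ, if_true]
    ring
  obtain ⟨u, M, hu, hnorm, heig, hmax⟩ := exists_pos_rayleigh_maximizer A (fun x => degR G x) hd
    (fun x y => by
      rcases eq_or_ne x y with rfl | hxy
      · rfl
      · simp [A, hxy, hxy.symm, G.adj_comm])
    (fun x y hxy => by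
      simp only [A, if_neg hxy, add_zero]
      split_ifs <;> norm_num)
    (G.induce (↑Λ : Set V)) hconn.preconnected
    (fun x y hxy => by
      have hadj : G.Adj x y := hxy
      have hxy' : x ≠ y := fun h => hxy.ne h
      simp [A, hadj, hxy'])
  let φ : V → ℝ := Function.extend Subtype.val u fun _ => 0
  have hφu : ∀ x : Λ, φ x = u x := fun x => Subtype.val_injective.extend_apply u _ x
  have hφ : ∀ x ∉ Λ, φ x = 0 := fun x hx =>
    Function.extend_apply' (f := Subtype.val) u _ x fun ⟨y, hy⟩ => hx (hy ▸ y.2)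
  have hφnorm : dInner G φ φ = 1 := by
    simpa only [dInner_self_eq_sum G hφ, hφu] using hnorm
  have hφeig : ∀ x : Λ, degR G x * (lapl G φ x + q x * φ x) = M * (degR G x * φ x) := by
    intro x
    rw [hop φ hφ]
    simp only [hφu, heig]
  have hpev : pev G Λ q = M := by
    refine IsGreatest.csSup_eq ⟨⟨φ, hφ, hφnorm, ?_⟩, ?_⟩
    · rw [← Finset.sum_coe_sort Λ fun x => degR G x * (lapl G φ x + q x * φ x) * φ x]
      simp only [hφeig, mul_assoc M, ← Finset.mul_sum]
      rw [← dInner_self_eq_sum G hφ, hφnorm, mul_one]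
    · rintro _ ⟨ψ, hψ, hψnorm, rfl⟩
      rw [← Finset.sum_coe_sort Λ fun x => degR G x * (lapl G ψ x + q x * ψ x) * ψ x]
      simp only [hop ψ hψ]
      exact hmax (fun x => ψ x) (by rw [← dInner_self_eq_sum G hψ, hψnorm])
  refine ⟨φ, hφ, hφnorm, fun x hx => ?_, fun x hx => ?_⟩
  · exact (hu ⟨x, hx⟩).trans_eq (hφu ⟨x, hx⟩).symm
  · rw [hpev]
    refine mul_left_cancel₀ (hd ⟨x, hx⟩).ne' ?_
    rw [hφeig ⟨x, hx⟩]
    ring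
end

section
/- If G = (V,E) is in addition connected, then for every ρ > 0, χ_G(ρ) = inf{ I_E(p) + ρ J_V(p) : p ∈ 𝒫(V), p has finite support }; i.e. restricting the infimum defining χ_G(ρ) to finitely supported probability measures does not change its value. -/
open scoped ENNReal BigOperators

/-- the functional `I_E(p)`, with values in `[0,∞]` -/
noncomputable def IE {V : Type*} (G : SimpleGraph V) (p : V → ℝ) : ℝ≥0∞ :=
  ∑' e : G.edgeSet,
    ENNReal.ofReal
      (Sym2.lift ⟨fun x y => (Real.sqrt (p x / degR G x) - Real.sqrt (p y / degR G y)) ^ 2,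
        fun x y => by ring⟩ e.1)

/-- the entropy functional `J_V(p)`, with values in `[0,∞]`
(the convention `0 · log 0 = 0` is automatic since `Real.log 0 = 0`) -/
noncomputable def JV {V : Type*} (p : V → ℝ) : ℝ≥0∞ :=
  ∑' x, ENNReal.ofReal (-(p x * Real.log (p x)))

/-- `p` is a probability measure on `V` -/
def IsProb {V : Type*} (p : V → ℝ) : Prop :=
  (∀ x, 0 ≤ p x) ∧ (∀ x, p x ≤ 1) ∧ HasSum p 1

/-- the variational constant `χ_G(ρ)` -/
noncomputable def chi {V : Type*} (G : SimpleGraph V) (ρ : ℝ) : ℝ≥0∞ :=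
  ⨅ (p : V → ℝ) (_ : IsProb p), IE G p + ENNReal.ofReal ρ * JV p

open Filter Topology

/-- The energy density of an edge in the definition of `IE`. -/
noncomputable def edgeEnergy {V : Type*} (G : SimpleGraph V) (p : V → ℝ) (e : G.edgeSet) : ℝ :=
  Sym2.lift ⟨fun x y => (Real.sqrt (p x / degR G x) - Real.sqrt (p y / degR G y)) ^ 2,
        fun x y => by ring⟩ e.1

lemma edgeEnergy_eq {V : Type*} (G : SimpleGraph V) (p : V → ℝ) (e : G.edgeSet) :
    edgeEnergy G p e = (Real.sqrt (p e.1.out.1 / degR G e.1.out.1)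
      - Real.sqrt (p e.1.out.2 / degR G e.1.out.2)) ^ 2 := by
  have h : e.1 = s(e.1.out.1, e.1.out.2) := e.1.out_eq.symm
  unfold edgeEnergy
  conv_lhs => rw [h]
  rfl

lemma edgeEnergy_nonneg {V : Type*} (G : SimpleGraph V) (p : V → ℝ) (e : G.edgeSet) :
    0 ≤ edgeEnergy G p e := by
  rw [edgeEnergy_eq]
  positivity

lemma degR_nonneg {V : Type*} (G : SimpleGraph V) (x : V) : 0 ≤ degR G x :=
  Nat.cast_nonneg _

/-- An upper bound for the energy density of an edge. -/
noncomputable def edgeMass {V : Type*} (G : SimpleGraph V) (p : V → ℝ) (e : G.edgeSet) : ℝ :=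
  p e.1.out.1 / degR G e.1.out.1 + p e.1.out.2 / degR G e.1.out.2

lemma edgeEnergy_le_edgeMass {V : Type*} (G : SimpleGraph V) {p : V → ℝ} (hp : ∀ x, 0 ≤ p x)
    (e : G.edgeSet) : edgeEnergy G p e ≤ edgeMass G p e := by
  rw [edgeEnergy_eq, edgeMass]
  have h1 := Real.sq_sqrt (div_nonneg (hp e.1.out.1) (degR_nonneg G e.1.out.1))
  have h2 := Real.sq_sqrt (div_nonneg (hp e.1.out.2) (degR_nonneg G e.1.out.2))
  have h3 := mul_nonneg (Real.sqrt_nonneg (p e.1.out.1 / degR G e.1.out.1))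
    (Real.sqrt_nonneg (p e.1.out.2 / degR G e.1.out.2))
  nlinarith

lemma summable_edgeMass {V : Type*} (G : SimpleGraph V) (hlf : ∀ x, (G.neighborSet x).Finite)
    {p : V → ℝ} (hp : ∀ x, 0 ≤ p x) (hs : Summable p) : Summable (edgeMass G p) := by
  have hadj : ∀ e : G.edgeSet, G.Adj e.1.out.1 e.1.out.2 := fun e => by
    have h : s(e.1.out.1, e.1.out.2) = e.1 := e.1.out_eq
    rw [← SimpleGraph.mem_edgeSet, h]
    exact e.2
  have hdart : Summable
      (fun d : (x : V) × G.neighborSet x => p d.1 / degR G d.1) := by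
    rw [summable_sigma_of_nonneg (fun d => div_nonneg (hp _) (degR_nonneg G _))]
    refine ⟨fun x => ?_, ?_⟩
    · have := (hlf x).to_subtype
      exact Summable.of_finite
    · refine Summable.of_nonneg_of_le
        (fun x => tsum_nonneg fun _ => div_nonneg (hp _) (degR_nonneg G _)) (fun x => ?_) hs
      change ∑' _ : G.neighborSet x, p x / degR G x ≤ p x
      rw [tsum_const, nsmul_eq_mul, Nat.card_coe_set_eq]
      change degR G x * (p x / degR G x) ≤ p x
      rw [mul_div_left_comm]
      exact mul_le_of_le_one_right (hp x) (div_self_le_one _)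
  let i : G.edgeSet → (x : V) × G.neighborSet x := fun e => ⟨e.1.out.1, e.1.out.2, hadj e⟩
  let j : G.edgeSet → (x : V) × G.neighborSet x := fun e => ⟨e.1.out.2, e.1.out.1, (hadj e).symm⟩
  have hext : ∀ e f : G.edgeSet, e.1.out.1 = f.1.out.1 → e.1.out.2 = f.1.out.2 → e = f := by
    intro e f h1 h2
    have he : s(e.1.out.1, e.1.out.2) = e.1 := e.1.out_eq
    have hf : s(f.1.out.1, f.1.out.2) = f.1 := f.1.out_eq
    exact Subtype.ext (by rw [← he, ← hf, h1, h2])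
  have hi : Function.Injective i := fun e f hef => hext e f
    (congrArg (fun d => d.1) hef)
    (congrArg (fun d : (x : V) × G.neighborSet x => (d.2 : V)) hef)
  have hj : Function.Injective j := fun e f hef => hext e f
    (congrArg (fun d : (x : V) × G.neighborSet x => (d.2 : V)) hef)
    (congrArg (fun d => d.1) hef)
  exact ((hdart.comp_injective hi).add (hdart.comp_injective hj)).congr fun _ => rfl

lemma IE_eq_ofReal_tsum {V : Type*} (G : SimpleGraph V) (hlf : ∀ x, (G.neighborSet x).Finite)
    {p : V → ℝ} (hp : IsProb p) : IE G p = ENNReal.ofReal (∑' e, edgeEnergy G p e) :=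
  (ENNReal.ofReal_tsum_of_nonneg (edgeEnergy_nonneg G p)
    (.of_nonneg_of_le (edgeEnergy_nonneg G p) (edgeEnergy_le_edgeMass G hp.1)
      (summable_edgeMass G hlf hp.1 hp.2.2.summable))).symm

/-- The normalized restriction of `p` to the finite set `A`. -/
noncomputable def truncate {V : Type*} (p : V → ℝ) (A : Finset V) (x : V) : ℝ :=
  (A : Set V).indicator p x / ∑ y ∈ A, p y

lemma isProb_truncate {V : Type*} {p : V → ℝ} (hp : IsProb p) {A : Finset V}
    (hA : 0 < ∑ y ∈ A, p y) : IsProb (truncate p A) := by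
  have h0 : ∀ x, 0 ≤ truncate p A x := fun x =>
    div_nonneg (Set.indicator_nonneg (fun x _ => hp.1 x) x) hA.le
  have hsum : HasSum (truncate p A) 1 := by
    have h : HasSum ((A : Set V).indicator p) (∑ y ∈ A, p y) := by
      rw [← hasSum_subtype_iff_indicator]
      exact A.hasSum p
    have h' : HasSum (truncate p A) _ := h.div_const (∑ y ∈ A, p y)
    rwa [div_self hA.ne'] at h'
  exact ⟨h0, fun x => le_hasSum hsum x fun y _ => h0 y, hsum⟩

lemma support_truncate_finite {V : Type*} (p : V → ℝ) (A : Finset V) :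
    (Function.support (truncate p A)).Finite := by
  refine A.finite_toSet.subset fun x hx => ?_
  by_contra h
  exact hx (by simp [truncate, Set.indicator_of_notMem h])

lemma tendsto_truncate {V : Type*} {p : V → ℝ} (hp : IsProb p) (x : V) :
    Tendsto (fun A => truncate p A x) atTop (𝓝 (p x)) := by
  have h1 : Tendsto (fun A : Finset V => (A : Set V).indicator p x) atTop (𝓝 (p x)) := by
    refine tendsto_const_nhds.congr' ?_
    filter_upwards [eventually_ge_atTop {x}] with A hA
    exact (Set.indicator_of_mem (by simpa using hA) p).symm
  have h2 : Tendsto (fun A : Finset V => ∑ y ∈ A, p y) atTop (𝓝 1) := hp.2.2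
  have h3 := h1.div h2 one_ne_zero
  rw [div_one] at h3
  exact h3

lemma truncate_le {V : Type*} {p : V → ℝ} (hp : IsProb p) {A : Finset V}
    (hA : 1 / 2 ≤ ∑ y ∈ A, p y) (x : V) : truncate p A x ≤ 2 * p x := by
  rw [truncate, div_le_iff₀ (by linarith)]
  have := Set.indicator_le_self' (s := (A : Set V)) (f := p) (fun x _ => hp.1 x) x
  nlinarith [hp.1 x]

lemma negMulLog_truncate_le {V : Type*} {p : V → ℝ} (hp : IsProb p) {A : Finset V}
    (hA : 1 / 2 ≤ ∑ y ∈ A, p y) (x : V) :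
    (truncate p A x).negMulLog ≤ 2 * (p x).negMulLog := by
  have hnn := Real.negMulLog_nonneg (hp.1 x) (hp.2.1 x)
  by_cases hx : x ∈ A
  · have hc1 : ∑ y ∈ A, p y ≤ 1 := sum_le_hasSum A (fun y _ => hp.1 y) hp.2.2
    have hle := truncate_le hp hA x
    rw [truncate, Set.indicator_of_mem (by simpa using hx)] at hle ⊢
    set c := ∑ y ∈ A, p y
    rcases (hp.1 x).eq_or_lt with h | h
    · simp [← h]
    · have hpc : 0 < p x / c := by positivity
      have hlog : Real.log (p x) ≤ Real.log (p x / c) :=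
        Real.log_le_log h (by rw [le_div_iff₀ (by linarith)]; nlinarith)
      have hlog' : Real.log (p x) ≤ 0 := Real.log_nonpos h.le (hp.2.1 x)
      simp only [Real.negMulLog]
      nlinarith [mul_le_mul_of_nonneg_left hlog hpc.le, mul_le_mul_of_nonpos_right hle hlog']
  · rw [truncate, Set.indicator_of_notMem (by simpa using hx)]
    simpa using hnn

lemma JV_eq_tsum_negMulLog {V : Type*} (p : V → ℝ) :
    JV p = ∑' x, ENNReal.ofReal (p x).negMulLog := by
  simp [JV, Real.negMulLog]

lemma tendsto_IE_truncate {V : Type*} (G : SimpleGraph V)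
    (hlf : ∀ x, (G.neighborSet x).Finite) {p : V → ℝ} (hp : IsProb p) :
    Tendsto (fun A => IE G (truncate p A)) atTop (𝓝 (IE G p)) := by
  have hlarge : ∀ᶠ A : Finset V in atTop, 1 / 2 ≤ ∑ y ∈ A, p y :=
    Tendsto.eventually_const_le (by norm_num) hp.2.2
  have key : Tendsto (fun A => ∑' e, edgeEnergy G (truncate p A) e) atTop
      (𝓝 (∑' e, edgeEnergy G p e)) := by
    refine tendsto_tsum_of_dominated_convergence
      ((summable_edgeMass G hlf hp.1 hp.2.2.summable).mul_left 2) (fun e => ?_) ?_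
    · simp only [edgeEnergy_eq]
      exact (((tendsto_truncate hp _).div_const _).sqrt.sub
        ((tendsto_truncate hp _).div_const _).sqrt).pow 2
    · filter_upwards [hlarge] with A hA e
      rw [Real.norm_of_nonneg (edgeEnergy_nonneg G _ e)]
      refine (edgeEnergy_le_edgeMass G (isProb_truncate hp (by linarith)).1 e).trans ?_
      rw [edgeMass, edgeMass, mul_add, ← mul_div_assoc, ← mul_div_assoc]
      exact add_le_add
        (div_le_div_of_nonneg_right (truncate_le hp hA _) (degR_nonneg G _))
        (div_le_div_of_nonneg_right (truncate_le hp hA _) (degR_nonneg G _))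
  rw [IE_eq_ofReal_tsum G hlf hp]
  refine (ENNReal.tendsto_ofReal key).congr' ?_
  filter_upwards [hlarge] with A hA
  exact (IE_eq_ofReal_tsum G hlf (isProb_truncate hp (by linarith))).symm

lemma tendsto_JV_truncate {V : Type*} {p : V → ℝ} (hp : IsProb p) (hJ : JV p ≠ ⊤) :
    Tendsto (fun A => JV (truncate p A)) atTop (𝓝 (JV p)) := by
  have hlarge : ∀ᶠ A : Finset V in atTop, 1 / 2 ≤ ∑ y ∈ A, p y :=
    Tendsto.eventually_const_le (by norm_num) hp.2.2
  have hnn : ∀ {q : V → ℝ}, IsProb q → ∀ x, 0 ≤ (q x).negMulLog := fun hq x =>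
    Real.negMulLog_nonneg (hq.1 x) (hq.2.1 x)
  have hs : Summable fun x => (p x).negMulLog := by
    rw [JV_eq_tsum_negMulLog] at hJ
    exact (ENNReal.summable_toReal hJ).congr fun x => ENNReal.toReal_ofReal (hnn hp x)
  have key : Tendsto (fun A => ∑' x, (truncate p A x).negMulLog) atTop
      (𝓝 (∑' x, (p x).negMulLog)) := by
    refine tendsto_tsum_of_dominated_convergence (hs.mul_left 2) (fun x => ?_) ?_
    · exact (Real.continuous_negMulLog.tendsto _).comp (tendsto_truncate hp x)
    · filter_upwards [hlarge] with A hA x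
      rw [Real.norm_of_nonneg (hnn (isProb_truncate hp (by linarith)) x)]
      exact negMulLog_truncate_le hp hA x
  rw [JV_eq_tsum_negMulLog, ← ENNReal.ofReal_tsum_of_nonneg (hnn hp) hs]
  refine (ENNReal.tendsto_ofReal key).congr' ?_
  filter_upwards [hlarge] with A hA
  have hq := hnn (isProb_truncate hp (A := A) (by linarith))
  rw [JV_eq_tsum_negMulLog]
  exact ENNReal.ofReal_tsum_of_nonneg hq
    (.of_nonneg_of_le hq (negMulLog_truncate_le hp hA) (hs.mul_left 2))

/-- for a connected graph, restricting the infimum defining `χ_G(ρ)`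
to finitely supported probability measures does not change its value. -/
theorem chi_finite_support {V : Type*} (G : SimpleGraph V)
    (hlf : ∀ x, (G.neighborSet x).Finite)
    (hdeg : ∀ x, (G.neighborSet x).Nonempty)
    (hconn : G.Connected) (ρ : ℝ) (hρ : 0 < ρ) :
    chi G ρ
      = ⨅ (p : V → ℝ) (_ : IsProb p ∧ (Function.support p).Finite),
          IE G p + ENNReal.ofReal ρ * JV p := by
  apply le_antisymm
  · exact le_iInf₂ fun p hp => iInf₂_le p hp.1
  · refine le_iInf₂ fun p hp => ?_
    by_cases hJ : JV p = ⊤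
    · rw [hJ, ENNReal.mul_top (by simpa using hρ), add_top]
      exact le_top
    · refine ge_of_tendsto ((tendsto_IE_truncate G hlf hp).add
        (ENNReal.Tendsto.const_mul (tendsto_JV_truncate hp hJ) (.inr ENNReal.ofReal_ne_top))) ?_
      have hlarge : ∀ᶠ A : Finset V in atTop, 1 / 2 ≤ ∑ y ∈ A, p y :=
        Tendsto.eventually_const_le (by norm_num) hp.2.2
      filter_upwards [hlarge] with A hA
      exact iInf₂_le (truncate p A)
        ⟨isProb_truncate hp (by linarith), support_truncate_finite p A⟩
end

section
/- Let d ∈ ℕ with d ≥ 2. Let T̊ be an infinite, locally finite tree having one distinguished vertex O of degree d − 1 and all other vertices of degree d, and let T be an infinite tree in which every vertex has degree d. Then for every ρ > 0, χ_{T̊}(ρ) ≤ χ_T(ρ) ≤ χ_{T̊}(ρ) + 1/(d − 1). -/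
open scoped ENNReal BigOperators

/-- `par` and `ht` are the parent map and the height function of `G` rooted at `r`. -/
structure IsRooting {V : Type*} (G : SimpleGraph V) (r : V) (par : V → V) (ht : V → ℕ) :
    Prop where
  ht_root : ht r = 0
  ht_par : ∀ x, x ≠ r → ht (par x) + 1 = ht x
  adj_iff : ∀ x y, G.Adj x y ↔ (x ≠ r ∧ par x = y) ∨ (y ≠ r ∧ par y = x)

/-- the set of children of `v` -/
def childSet {V : Type*} (r : V) (par : V → V) (v : V) : Set V := {x | x ≠ r ∧ par x = v}

theorem exists_isRooting {V : Type*} {G : SimpleGraph V} (hG : G.IsTree) (r : V) :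
    ∃ par ht, IsRooting G r par ht := by
  have hpar : ∀ x, ∃ y, x ≠ r → G.Adj x y ∧ G.dist r y + 1 = G.dist r x := by
    intro x
    by_cases hx : x = r
    · exact ⟨x, fun h => absurd hx h⟩
    obtain ⟨p, hp⟩ := hG.connected.exists_walk_length_eq_dist r x
    have hnil : ¬ p.Nil := fun h => hx h.eq.symm
    refine ⟨p.penultimate, fun _ => ⟨(p.adj_penultimate hnil).symm, ?_⟩⟩
    have h1 := SimpleGraph.dist_le p.dropLast
    have h2 := SimpleGraph.Walk.length_dropLast_add_one hnil
    rcases hG.dist_eq_dist_add_one_of_adj r (p.adj_penultimate hnil) with h | h <;> omega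
  choose par hpar using hpar
  have huniq : ∀ x y, G.Adj x y → G.dist r y + 1 = G.dist r x → x ≠ r ∧ par x = y := by
    intro x y hxy hd
    have hx : x ≠ r := by
      rintro rfl
      simp at hd
    obtain ⟨q, hq⟩ := hG.connected.exists_walk_length_eq_dist r x
    have hqp := q.isPath_of_length_eq_dist hq
    have key : ∀ z, G.Adj x z → G.dist r z + 1 = G.dist r x → z = q.penultimate := by
      intro z hz hdz
      obtain ⟨p, hp⟩ := hG.connected.exists_walk_length_eq_dist r z
      have hpp := p.isPath_of_length_eq_dist hp
      refine hG.isAcyclic.eq_penultimate_of_adj_end hqp hz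
        (hG.isAcyclic.mem_support_of_ne_mem_support_of_adj_of_isPath hqp hpp hz ?_)
      intro hmem
      classical
      have h1 := SimpleGraph.dist_le (p.takeUntil x hmem)
      have h2 := p.length_takeUntil_le_length hmem
      omega
    exact ⟨hx, (key _ (hpar x hx).1 (hpar x hx).2).trans (key y hxy hd).symm⟩
  refine ⟨par, G.dist r, by simp, fun x hx => (hpar x hx).2, fun x y => ⟨fun h => ?_, ?_⟩⟩
  · rcases hG.dist_eq_dist_add_one_of_adj r h with h' | h'
    · exact Or.inl (huniq x y h h'.symm)
    · exact Or.inr (huniq y x h.symm h'.symm)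
  · rintro (⟨hx, rfl⟩ | ⟨hy, rfl⟩)
    · exact (hpar x hx).1
    · exact (hpar y hy).1.symm

namespace IsRooting

variable {V : Type*} {G : SimpleGraph V} {r : V} {par : V → V} {ht : V → ℕ}

theorem neighborSet_root (h : IsRooting G r par ht) : G.neighborSet r = childSet r par r := by
  ext y
  simp [h.adj_iff, childSet]

theorem neighborSet_eq_insert (h : IsRooting G r par ht) {v : V} (hv : v ≠ r) :
    G.neighborSet v = insert (par v) (childSet r par v) := by
  ext y
  simp [h.adj_iff, childSet, hv, eq_comm]

theorem par_notMem_childSet (h : IsRooting G r par ht) {v : V} (hv : v ≠ r) :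
    par v ∉ childSet r par v := by
  rintro ⟨h1, h2⟩
  have h3 := h.ht_par _ hv
  have h4 := h.ht_par _ h1
  rw [h2] at h4
  omega

theorem encard_childSet (h : IsRooting G r par ht) {v : V} (hv : v ≠ r) {d : ℕ} (hd : 2 ≤ d)
    (hcard : (G.neighborSet v).ncard = d) : (childSet r par v).encard = (d - 1 : ℕ) := by
  have hfin : (G.neighborSet v).Finite := Set.finite_of_ncard_ne_zero (by omega)
  rw [h.neighborSet_eq_insert hv] at hfin hcard
  have hfin' := hfin.subset (Set.subset_insert _ _)
  rw [Set.ncard_insert_of_notMem (h.par_notMem_childSet hv) hfin'] at hcard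
  rw [← hfin'.cast_ncard_eq]
  congr 1
  omega

theorem exists_ht_eq (h : IsRooting G r par ht) (hne : ∀ v, (childSet r par v).Nonempty) (n : ℕ) :
    ∃ v, ht v = n := by
  induction n with
  | zero => exact ⟨r, h.ht_root⟩
  | succ n ih =>
    obtain ⟨v, hv⟩ := ih
    obtain ⟨x, hx, hxv⟩ := hne v
    exact ⟨x, by rw [← h.ht_par x hx, hxv, hv]⟩

/-- Two rooted trees with the same branching number: the first embeds in the second as the set of
descendants of a given child `a` of the root. -/
theorem exists_embedding {W : Type*} {G₀ : SimpleGraph W} {r₀ : W} {par₀ : W → W} {ht₀ : W → ℕ}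
    (h₀ : IsRooting G₀ r₀ par₀ ht₀) (h : IsRooting G r par ht) {k : ℕ}
    (hk₀ : ∀ x, (childSet r₀ par₀ x).encard = k)
    (hk : ∀ v, v ≠ r → (childSet r par v).encard = k) {a : V} (ha : a ∈ childSet r par r) :
    ∃ φ : W → V, Function.Injective φ ∧ φ r₀ = a ∧ (∀ x, φ x ≠ r) ∧
      (∀ x, x ≠ r₀ → par (φ x) = φ (par₀ x)) ∧
      ∀ v, v ≠ r → par v ∈ Set.range φ → v ∈ Set.range φ := by
  have hbij : ∀ x v, ∃ c : W → V, v ≠ r → Set.BijOn c (childSet r₀ par₀ x) (childSet r par v) := by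
    intro x v
    by_cases hv : v = r
    · exact ⟨fun _ => v, fun h => absurd hv h⟩
    have : Nonempty V := ⟨v⟩
    have hfin : (childSet r₀ par₀ x).Finite := Set.finite_of_encard_eq_coe (hk₀ x)
    obtain ⟨c, hc⟩ := hfin.exists_bijOn_of_encard_eq ((hk₀ x).trans (hk v hv).symm)
    exact ⟨c, fun _ => hc⟩
  choose c hc using hbij
  let ψ : ℕ → W → V := fun n => Nat.rec (fun _ => a) (fun _ f x => c (par₀ x) (f (par₀ x)) x) n
  let φ : W → V := fun x => ψ (ht₀ x) x
  have hφ0 : φ r₀ = a := by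
    simp only [φ, h₀.ht_root]
    rfl
  have hφ : ∀ x, x ≠ r₀ → φ x = c (par₀ x) (φ (par₀ x)) x := by
    intro x hx
    simp only [φ, ← h₀.ht_par x hx]
    rfl
  have hind : ∀ P : W → Prop, P r₀ → (∀ x, x ≠ r₀ → P (par₀ x) → P x) → ∀ x, P x := by
    intro P h1 h2 x
    induction hn : ht₀ x using Nat.strong_induction_on generalizing x with
    | _ n ih =>
      by_cases hx : x = r₀
      · exact hx ▸ h1
      · exact h2 x hx (ih _ (by have := h₀.ht_par x hx; omega) _ rfl)
  have hner : ∀ x, φ x ≠ r := by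
    refine hind _ (hφ0 ▸ ha.1) fun x hx ih => ?_
    rw [hφ x hx]
    exact ((hc (par₀ x) _ ih).mapsTo ⟨hx, rfl⟩).1
  have hpar : ∀ x, x ≠ r₀ → par (φ x) = φ (par₀ x) := by
    intro x hx
    rw [hφ x hx]
    exact ((hc (par₀ x) _ (hner _)).mapsTo ⟨hx, rfl⟩).2
  have hht : ∀ x, ht (φ x) = ht₀ x + 1 := by
    refine hind _ ?_ fun x hx ih => ?_
    · rw [hφ0, ← h.ht_par a ha.1, ha.2, h.ht_root, h₀.ht_root]
    · rw [← h.ht_par _ (hner x), hpar x hx, ih, h₀.ht_par x hx]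
  refine ⟨φ, fun x => ?_, hφ0, hner, hpar, ?_⟩
  · refine hind (fun x => ∀ ⦃y⦄, φ x = φ y → x = y) ?_ ?_ x
    · intro y hxy
      by_contra hne
      have h1 := hht r₀
      have h2 := hht y
      have h3 := h₀.ht_par y (Ne.symm hne)
      rw [hxy] at h1
      have := h₀.ht_root
      omega
    · intro x hx ih y hxy
      have hy : y ≠ r₀ := by
        rintro rfl
        have h1 := hht x
        have h2 := hht y
        have h3 := h₀.ht_par x hx
        rw [hxy] at h1
        have := h₀.ht_root
        omega
      have hp : par₀ x = par₀ y := ih (by rw [← hpar x hx, ← hpar y hy, hxy])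
      rw [hφ x hx, hφ y hy, ← hp] at hxy
      exact (hc (par₀ x) _ (hner _)).injOn ⟨hx, rfl⟩ ⟨hy, hp.symm⟩ hxy
  · rintro v hv ⟨x, hx⟩
    obtain ⟨y, hy, rfl⟩ := (hc x (φ x) (hner x)).surjOn ⟨hv, hx.symm⟩
    refine ⟨y, ?_⟩
    rw [hφ y hy.1, hy.2]

/-- The edges of a rooted tree correspond to the vertices other than the root. -/
theorem tsum_edgeSet (h : IsRooting G r par ht) (f : Sym2 V → ℝ≥0∞) :
    ∑' e : G.edgeSet, f e = ∑' x : {x // x ≠ r}, f s(x.1, par x.1) := by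
  let g : {x // x ≠ r} → G.edgeSet := fun x =>
    ⟨s(x.1, par x.1), by
      rw [SimpleGraph.mem_edgeSet, h.adj_iff]
      exact Or.inl ⟨x.2, rfl⟩⟩
  have hg : Function.Bijective g := by
    constructor
    · rintro ⟨x, hx⟩ ⟨y, hy⟩ hxy
      have hxy' : s(x, par x) = s(y, par y) := congrArg Subtype.val hxy
      rw [Sym2.eq_iff] at hxy'
      rcases hxy' with ⟨h1, -⟩ | ⟨h1, h2⟩
      · exact Subtype.ext h1
      · have h3 := h.ht_par x hx
        have h4 := h.ht_par y hy
        rw [h2] at h3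
        rw [← h1] at h4
        omega
    · rintro ⟨e, he⟩
      induction e using Sym2.ind with
      | _ x y =>
        rw [SimpleGraph.mem_edgeSet, h.adj_iff] at he
        rcases he with ⟨hx, rfl⟩ | ⟨hy, rfl⟩
        · exact ⟨⟨x, hx⟩, rfl⟩
        · exact ⟨⟨y, hy⟩, Subtype.ext Sym2.eq_swap⟩
  exact ((Equiv.ofBijective g hg).tsum_eq (fun e : G.edgeSet => f e)).symm

end IsRooting

theorem IsRooting.IE_eq {V : Type*} {G : SimpleGraph V} {r : V} {par : V → V} {ht : V → ℕ}
    (h : IsRooting G r par ht) (p : V → ℝ) :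
    IE G p = ∑' x, {x | x ≠ r}.indicator (fun x => ENNReal.ofReal
      ((Real.sqrt (p x / degR G x) - Real.sqrt (p (par x) / degR G (par x))) ^ 2)) x := by
  rw [← tsum_subtype]
  exact h.tsum_edgeSet fun e => ENNReal.ofReal (Sym2.lift ⟨fun x y =>
    (Real.sqrt (p x / degR G x) - Real.sqrt (p y / degR G y)) ^ 2, fun x y => by ring⟩ e)

theorem sub_sq_le_sub_sq_add_sq {q A B : ℝ} (hB : 0 ≤ B) (hBA : B ≤ A) :
    (q - B) ^ 2 ≤ (q - A) ^ 2 + q ^ 2 := by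
  nlinarith [sq_nonneg (q - (A - B)), mul_nonneg hB (sub_nonneg.2 hBA)]

theorem sub_sq_le_sub_sq_add_sq' {q A B : ℝ} (hq : 0 ≤ q) (hBA : B ≤ A) :
    (q - A) ^ 2 ≤ (q - B) ^ 2 + A ^ 2 := by
  nlinarith [sq_nonneg B, mul_nonneg hq (sub_nonneg.2 hBA)]

section Embedding

variable {W V : Type*} {G₀ : SimpleGraph W} {r₀ : W} {par₀ : W → W} {ht₀ : W → ℕ}
  {G : SimpleGraph V} {r : V} {par : V → V} {ht : V → ℕ} {φ : W → V} {d : ℕ}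

theorem IE_extend_le (hd : 2 ≤ d) (h₀ : IsRooting G₀ r₀ par₀ ht₀) (h : IsRooting G r par ht)
    (hinj : Function.Injective φ) (hφr₀ : par (φ r₀) = r) (hφr : ∀ x, φ x ≠ r)
    (hφ : ∀ x, x ≠ r₀ → par (φ x) = φ (par₀ x))
    (hrange : ∀ v, v ≠ r → par v ∈ Set.range φ → v ∈ Set.range φ)
    (hr₀ : degR G₀ r₀ = (d : ℝ) - 1) (hdeg₀ : ∀ x, x ≠ r₀ → degR G₀ x = d)
    (hdeg : ∀ v, degR G v = d) {p : W → ℝ} (hp : IsProb p) :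
    IE G (Function.extend φ p 0) ≤ IE G₀ p + ENNReal.ofReal (1 / d) := by
  have hd' : (2 : ℝ) ≤ d := by exact_mod_cast hd
  have hnr : ∀ v, v ∉ Set.range φ → Function.extend φ p 0 v = 0 := by
    intro v hv
    rw [Function.extend_apply' _ _ _ hv]
    rfl
  have hsum : ∑' x, ENNReal.ofReal (p x / d) = ENNReal.ofReal (1 / d) := by
    have := hp.2.2.div_const (d : ℝ)
    rw [← ENNReal.ofReal_tsum_of_nonneg (fun x => div_nonneg (hp.1 x) (by positivity))
      this.summable, this.tsum_eq]
  rw [h.IE_eq, h₀.IE_eq, ← hsum, ← ENNReal.tsum_add, ← hinj.tsum_eq]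
  · refine ENNReal.tsum_le_tsum fun x => ?_
    rw [Set.indicator_of_mem (show φ x ∈ {v | v ≠ r} from hφr x), hinj.extend_apply, hdeg, hdeg]
    have hpx : 0 ≤ p x / d := div_nonneg (hp.1 x) (by positivity)
    by_cases hx : x = r₀
    · subst hx
      rw [Set.indicator_of_notMem (by simp), zero_add, hφr₀, hnr r (fun ⟨y, hy⟩ => hφr y hy)]
      apply ENNReal.ofReal_le_ofReal
      rw [zero_div, Real.sqrt_zero, sub_zero, Real.sq_sqrt hpx]
    · rw [Set.indicator_of_mem (show x ∈ {x | x ≠ r₀} from hx), hφ x hx, hinj.extend_apply,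
        hdeg₀ x hx, ← ENNReal.ofReal_add (sq_nonneg _) hpx]
      apply ENNReal.ofReal_le_ofReal
      by_cases hy : par₀ x = r₀
      · rw [hy, hr₀]
        have hle : p r₀ / d ≤ p r₀ / ((d : ℝ) - 1) :=
          div_le_div_of_nonneg_left (hp.1 _) (by linarith) (by linarith)
        have h1 := sub_sq_le_sub_sq_add_sq (q := Real.sqrt (p x / d)) (Real.sqrt_nonneg _)
          (Real.sqrt_le_sqrt hle)
        rwa [Real.sq_sqrt hpx] at h1
      · rw [hdeg₀ _ hy]
        linarith
  · intro v hv
    by_contra hvr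
    apply hv
    by_cases hv' : v = r
    · simp [hv']
    · rw [Set.indicator_of_mem (show v ∈ {v | v ≠ r} from hv'), hnr v hvr,
        hnr (par v) fun hmem => hvr (hrange v hv' hmem)]
      simp

theorem IE_comp_le (hd : 2 ≤ d) (h₀ : IsRooting G₀ r₀ par₀ ht₀) (h : IsRooting G r par ht)
    (hinj : Function.Injective φ) (hφr : ∀ x, φ x ≠ r)
    (hφ : ∀ x, x ≠ r₀ → par (φ x) = φ (par₀ x))
    (hr₀ : degR G₀ r₀ = (d : ℝ) - 1) (hdeg₀ : ∀ x, x ≠ r₀ → degR G₀ x = d)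
    (hdeg : ∀ v, degR G v = d) {p : V → ℝ} (hp : ∀ v, 0 ≤ p v) :
    IE G₀ (p ∘ φ) ≤
      IE G p + (childSet r₀ par₀ r₀).encard * ENNReal.ofReal (p (φ r₀)) := by
  have hd' : (2 : ℝ) ≤ d := by exact_mod_cast hd
  have hsum : ∑' x, (childSet r₀ par₀ r₀).indicator (fun _ => ENNReal.ofReal (p (φ r₀))) x =
      (childSet r₀ par₀ r₀).encard * ENNReal.ofReal (p (φ r₀)) := by
    rw [← tsum_subtype, ENNReal.tsum_set_const]
  rw [h.IE_eq, h₀.IE_eq, ← hsum]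
  refine le_trans ?_ (add_le_add_left (ENNReal.tsum_comp_le_tsum_of_injective hinj _) _)
  rw [← ENNReal.tsum_add]
  refine ENNReal.tsum_le_tsum fun x => ?_
  by_cases hx : x = r₀
  · subst hx
    simp
  rw [Set.indicator_of_mem (show φ x ∈ {v | v ≠ r} from hφr x),
    Set.indicator_of_mem (show x ∈ {x | x ≠ r₀} from hx), hdeg, hdeg, hφ x hx, hdeg₀ x hx]
  by_cases hy : par₀ x = r₀
  · rw [Set.indicator_of_mem (show x ∈ childSet r₀ par₀ r₀ from ⟨hx, hy⟩),
      ← ENNReal.ofReal_add (sq_nonneg _) (hp _), hy, hr₀]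
    apply ENNReal.ofReal_le_ofReal
    simp only [Function.comp_apply]
    have hs := hp (φ r₀)
    have hle : p (φ r₀) / d ≤ p (φ r₀) / ((d : ℝ) - 1) :=
      div_le_div_of_nonneg_left hs (by linarith) (by linarith)
    have h1 := sub_sq_le_sub_sq_add_sq' (Real.sqrt_nonneg (p (φ x) / d)) (Real.sqrt_le_sqrt hle)
    rw [Real.sq_sqrt (div_nonneg hs (by linarith))] at h1
    have h2 : p (φ r₀) / ((d : ℝ) - 1) ≤ p (φ r₀) := div_le_self hs (by linarith)
    linarith
  · rw [hdeg₀ _ hy]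
    exact le_self_add

end Embedding

theorem JV_extend {W V : Type*} {φ : W → V} (hinj : Function.Injective φ) (p : W → ℝ) :
    JV (Function.extend φ p 0) = JV p := by
  unfold JV
  rw [← hinj.tsum_eq]
  · simp [hinj.extend_apply]
  · intro v hv
    by_contra hvr
    apply hv
    simp [Function.extend_apply' _ _ _ hvr]

theorem IsProb.extend {W V : Type*} {φ : W → V} (hinj : Function.Injective φ) {p : W → ℝ}
    (hp : IsProb p) : IsProb (Function.extend φ p 0) := by
  refine ⟨fun v => ?_, fun v => ?_, (hasSum_extend_zero hinj).2 hp.2.2⟩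
  all_goals
    by_cases hv : v ∈ Set.range φ
    · obtain ⟨x, rfl⟩ := hv
      simp [hinj.extend_apply, hp.1 x, hp.2.1 x]
    · simp [Function.extend_apply' _ _ _ hv]

theorem IE_const_mul {V : Type*} (G : SimpleGraph V) {c : ℝ} (hc : 0 ≤ c) (p : V → ℝ) :
    IE G (fun x => c * p x) = ENNReal.ofReal c * IE G p := by
  unfold IE
  rw [← ENNReal.tsum_mul_left]
  congr 1
  ext ⟨e, he⟩
  induction e using Sym2.ind with
  | _ x y =>
    rw [← ENNReal.ofReal_mul hc]
    simp only [Sym2.lift_mk, mul_div_assoc, Real.sqrt_mul hc]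
    rw [← mul_sub, mul_pow, Real.sq_sqrt hc]

theorem JV_const_mul_le {V : Type*} {c : ℝ} (hc : 1 ≤ c) {p : V → ℝ} (hp : ∀ x, 0 ≤ p x) :
    JV (fun x => c * p x) ≤ ENNReal.ofReal c * JV p := by
  unfold JV
  rw [← ENNReal.tsum_mul_left]
  refine ENNReal.tsum_le_tsum fun x => ?_
  rw [← ENNReal.ofReal_mul (by linarith)]
  apply ENNReal.ofReal_le_ofReal
  rcases (hp x).eq_or_lt with h | h
  · simp [← h]
  · rw [Real.log_mul (by positivity) h.ne']
    have := mul_nonneg (mul_nonneg (by linarith : 0 ≤ c) h.le) (Real.log_nonneg hc)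
    nlinarith

/-- The variational constant bounds the functional at positive, possibly subprobability, masses. -/
theorem ofReal_mul_chi_le {V : Type*} (G : SimpleGraph V) (ρ : ℝ) {p : V → ℝ}
    (hp : ∀ x, 0 ≤ p x) {θ : ℝ} (hθ : 0 < θ) (hθ1 : θ ≤ 1) (hsum : HasSum p θ) :
    ENNReal.ofReal θ * chi G ρ ≤ IE G p + ENNReal.ofReal ρ * JV p := by
  have hprob : IsProb fun x => θ⁻¹ * p x := by
    have hs := hsum.mul_left θ⁻¹
    rw [inv_mul_cancel₀ hθ.ne'] at hs
    have h0 : ∀ x, 0 ≤ θ⁻¹ * p x := fun x => mul_nonneg (by positivity) (hp x)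
    exact ⟨h0, fun x => le_hasSum hs x fun y _ => h0 y, hs⟩
  have hone : ENNReal.ofReal θ * ENNReal.ofReal θ⁻¹ = 1 := by
    rw [← ENNReal.ofReal_mul hθ.le, mul_inv_cancel₀ hθ.ne', ENNReal.ofReal_one]
  calc ENNReal.ofReal θ * chi G ρ
      ≤ ENNReal.ofReal θ * (IE G (fun x => θ⁻¹ * p x) +
          ENNReal.ofReal ρ * JV fun x => θ⁻¹ * p x) := by
        gcongr
        exact iInf₂_le _ hprob
    _ ≤ ENNReal.ofReal θ * (ENNReal.ofReal θ⁻¹ * IE G p +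
          ENNReal.ofReal ρ * (ENNReal.ofReal θ⁻¹ * JV p)) := by
        rw [IE_const_mul G (by positivity)]
        gcongr
        exact JV_const_mul_le ((one_le_inv₀ hθ).2 hθ1) hp
    _ = (ENNReal.ofReal θ * ENNReal.ofReal θ⁻¹) * (IE G p + ENNReal.ofReal ρ * JV p) := by ring
    _ = _ := by rw [hone, one_mul]

/-- A set closed under adjacency except at `b`, containing the parent of `b`, contains every vertex
less high than `b`. -/
theorem IsRooting.mem_of_ht_lt {V : Type*} {G : SimpleGraph V} {r : V} {par : V → V} {ht : V → ℕ}
    (h : IsRooting G r par ht) {S : Set V} {b : V} (hb : b ≠ r) (hbS : par b ∈ S)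
    (hS : ∀ u ∈ S, ∀ v, v ≠ b → G.Adj u v → v ∈ S) {v : V} (hv : ht v < ht b) : v ∈ S := by
  have hroot : ∀ n, ∀ u ∈ S, ht u = n → ht u < ht b → r ∈ S := by
    intro n
    induction n with
    | zero =>
      intro u hu h0 _
      by_cases hur : u = r
      · exact hur ▸ hu
      · have := h.ht_par u hur
        omega
    | succ n ih =>
      intro u hu hn hub
      have hur : u ≠ r := by
        rintro rfl
        have := h.ht_root
        omega
      have hp := h.ht_par u hur
      refine ih (par u) (hS u hu _ ?_ ((h.adj_iff _ _).2 (Or.inl ⟨hur, rfl⟩))) (by omega)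
        (by omega)
      intro he
      rw [he] at hp
      omega
  have hrS : r ∈ S := hroot _ _ hbS rfl (by have := h.ht_par b hb; omega)
  induction hn : ht v using Nat.strong_induction_on generalizing v with
  | _ n ih =>
    by_cases hvr : v = r
    · exact hvr ▸ hrS
    have hp := h.ht_par v hvr
    refine hS _ (ih (ht (par v)) (by omega) (by omega) rfl) v ?_
      ((h.adj_iff _ _).2 (Or.inr ⟨hvr, rfl⟩))
    rintro rfl
    omega

/-- A priori bounds: if `T₀` (the "half-tree" `T̊`) is an infinite
locally finite tree with one distinguished vertex `O` of degree `d−1` and all other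
vertices of degree `d`, and `T` is an infinite tree in which every vertex has
degree `d`, then `χ_{T₀}(ρ) ≤ χ_T(ρ) ≤ χ_{T₀}(ρ) + 1/(d−1)`. -/
theorem chi_halftree_bounds {d : ℕ} (hd : 2 ≤ d)
    {W : Type*} [Infinite W] (T₀ : SimpleGraph W) (O : W)
    (hT₀lf : ∀ x, (T₀.neighborSet x).Finite)
    (hT₀tree : T₀.IsTree)
    (hO : (T₀.neighborSet O).ncard = d - 1)
    (hT₀deg : ∀ x, x ≠ O → (T₀.neighborSet x).ncard = d)
    {V : Type*} [Infinite V] (T : SimpleGraph V)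
    (hTtree : T.IsTree)
    (hTdeg : ∀ x, (T.neighborSet x).ncard = d)
    (ρ : ℝ) (hρ : 0 < ρ) :
    chi T₀ ρ ≤ chi T ρ ∧ chi T ρ ≤ chi T₀ ρ + ENNReal.ofReal (1 / ((d : ℝ) - 1)) := by
  have hdR : (2 : ℝ) ≤ d := by exact_mod_cast hd
  obtain ⟨par₀, ht₀, h₀⟩ := exists_isRooting hT₀tree O
  have hr₀ : degR T₀ O = (d : ℝ) - 1 := by
    unfold degR
    rw [hO, Nat.cast_sub (by omega), Nat.cast_one]
  have hdeg₀ : ∀ x, x ≠ O → degR T₀ x = d := fun x hx => by rw [degR, hT₀deg x hx]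
  have hdeg : ∀ v, degR T v = d := fun v => by rw [degR, hTdeg v]
  have hcard₀ : ∀ x, (childSet O par₀ x).encard = (d - 1 : ℕ) := by
    intro x
    by_cases hx : x = O
    · subst hx
      rw [← h₀.neighborSet_root, ← (hT₀lf x).cast_ncard_eq, hO]
    · exact h₀.encard_childSet hx hd (hT₀deg x hx)
  constructor
  · refine le_iInf₂ fun p hp => ?_
    have key : ∀ ε ∈ Set.Ioo (0 : ℝ) 1, ENNReal.ofReal (1 - ε) * chi T₀ ρ ≤
        IE T p + ENNReal.ofReal ρ * JV p + (d - 1 : ℕ) * ENNReal.ofReal ε := by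
      rintro ε ⟨hε, hε1⟩
      obtain ⟨F, hF⟩ : ∃ F : Finset V, 1 - ε < ∑ v ∈ F, p v :=
        (hp.2.2.eventually (lt_mem_nhds (by linarith : 1 - ε < 1))).exists
      obtain ⟨r⟩ : Nonempty V := inferInstance
      obtain ⟨par, ht, h⟩ := exists_isRooting hTtree r
      have hne : ∀ v, (childSet r par v).Nonempty := by
        intro v
        by_cases hv : v = r
        · subst hv
          rw [← h.neighborSet_root]
          exact Set.nonempty_of_ncard_ne_zero (by rw [hTdeg]; omega)
        · rw [← Set.encard_ne_zero, h.encard_childSet hv hd (hTdeg v)]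
          exact_mod_cast (by omega : d - 1 ≠ 0)
      obtain ⟨b, hb⟩ := h.exists_ht_eq hne (F.sup ht + 2)
      have hbr : b ≠ r := by
        rintro rfl
        have := h.ht_root
        omega
      have hFle : ∀ v ∈ F, ht v ≤ F.sup ht := fun v hv => Finset.le_sup hv
      have hpb := h.ht_par b hbr
      have hpbF : par b ∉ F := fun hmem => by
        have := hFle _ hmem
        omega
      obtain ⟨par', ht', h'⟩ := exists_isRooting hTtree b
      have hchild : par b ∈ childSet b par' b := by
        rw [← h'.neighborSet_root, SimpleGraph.mem_neighborSet, h.adj_iff]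
        exact Or.inl ⟨hbr, rfl⟩
      obtain ⟨φ, hinj, hφO, hφb, hφ, hrange⟩ := h₀.exists_embedding h' hcard₀
        (fun v hv => h'.encard_childSet hv hd (hTdeg v)) hchild
      have hFφ : ∀ v ∈ F, v ∈ Set.range φ := by
        intro v hv
        refine h.mem_of_ht_lt (S := Set.range φ) hbr ⟨O, hφO⟩ ?_ (by have := hFle v hv; omega)
        rintro _ ⟨x, rfl⟩ v hvb hadj
        rcases (h'.adj_iff _ _).1 hadj with ⟨-, hv⟩ | ⟨hv, hpv⟩
        · by_cases hx : x = O
          · rw [hx, hφO, hchild.2] at hv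
            exact absurd hv.symm hvb
          · exact ⟨par₀ x, by rw [← hφ x hx, hv]⟩
        · exact hrange v hv ⟨x, hpv.symm⟩
      have hsummable : Summable (p ∘ φ) := hp.2.2.summable.comp_injective hinj
      have hθ1 : ∑' x, (p ∘ φ) x ≤ 1 :=
        hp.2.2.tsum_eq ▸ tsum_comp_le_tsum_of_inj hp.2.2.summable hp.1 hinj
      have hθ : 1 - ε < ∑' x, (p ∘ φ) x := by
        refine hF.trans_le ?_
        rw [← Finset.sum_preimage φ F hinj.injOn p fun v hv hv' => absurd (hFφ v hv) hv']
        exact hsummable.sum_le_tsum _ fun x _ => hp.1 _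
      have hsmall : p (par b) ≤ ε := by
        classical
        have := sum_le_hasSum (insert (par b) F) (fun v _ => hp.1 v) hp.2.2
        rw [Finset.sum_insert hpbF] at this
        linarith
      calc ENNReal.ofReal (1 - ε) * chi T₀ ρ
          ≤ ENNReal.ofReal (∑' x, (p ∘ φ) x) * chi T₀ ρ := by gcongr
        _ ≤ IE T₀ (p ∘ φ) + ENNReal.ofReal ρ * JV (p ∘ φ) :=
            ofReal_mul_chi_le T₀ ρ (fun x => hp.1 _) (by linarith) hθ1 hsummable.hasSum
        _ ≤ (IE T p + (d - 1 : ℕ) * ENNReal.ofReal ε) + ENNReal.ofReal ρ * JV p := by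
            gcongr
            · refine (IE_comp_le hd h₀ h' hinj hφb hφ hr₀ hdeg₀ hdeg hp.1).trans ?_
              rw [hcard₀, hφO]
              gcongr
              simp
            · exact ENNReal.tsum_comp_le_tsum_of_injective hinj
                fun v => ENNReal.ofReal (-(p v * Real.log (p v)))
        _ = _ := by ring
    have hev : ∀ᶠ ε : ℝ in nhdsWithin 0 (Set.Ioi 0), ε ∈ Set.Ioo (0 : ℝ) 1 :=
      Ioo_mem_nhdsGT one_pos
    have hlim1 : Filter.Tendsto (fun ε : ℝ => ENNReal.ofReal (1 - ε) * chi T₀ ρ)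
        (nhdsWithin 0 (Set.Ioi 0)) (nhds (1 * chi T₀ ρ)) := by
      refine ENNReal.Tendsto.mul_const ?_ (Or.inl one_ne_zero)
      have : Filter.Tendsto (fun ε : ℝ => ENNReal.ofReal (1 - ε)) (nhds 0)
          (nhds (ENNReal.ofReal (1 - 0))) := by
        refine ENNReal.tendsto_ofReal ?_
        exact tendsto_const_nhds.sub Filter.tendsto_id
      rw [sub_zero, ENNReal.ofReal_one] at this
      exact this.mono_left nhdsWithin_le_nhds
    have hlim2 : Filter.Tendsto (fun ε : ℝ => IE T p + ENNReal.ofReal ρ * JV p +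
        ((d - 1 : ℕ) : ℝ≥0∞) * ENNReal.ofReal ε) (nhdsWithin 0 (Set.Ioi 0))
        (nhds (IE T p + ENNReal.ofReal ρ * JV p + ((d - 1 : ℕ) : ℝ≥0∞) * 0)) := by
      refine tendsto_const_nhds.add (ENNReal.Tendsto.const_mul ?_ (Or.inr (by simp)))
      have : Filter.Tendsto ENNReal.ofReal (nhds 0) (nhds (ENNReal.ofReal 0)) :=
        ENNReal.tendsto_ofReal Filter.tendsto_id
      rw [ENNReal.ofReal_zero] at this
      exact this.mono_left nhdsWithin_le_nhds
    simpa using le_of_tendsto_of_tendsto hlim1 hlim2 (hev.mono key)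
  · rw [chi, chi, ENNReal.iInf_add]
    refine le_iInf fun p => ?_
    rw [ENNReal.iInf_add]
    refine le_iInf fun hp => ?_
    obtain ⟨b⟩ : Nonempty V := inferInstance
    obtain ⟨par, ht, h⟩ := exists_isRooting hTtree b
    obtain ⟨a, ha⟩ : (childSet b par b).Nonempty := by
      rw [← h.neighborSet_root]
      exact Set.nonempty_of_ncard_ne_zero (by rw [hTdeg]; omega)
    obtain ⟨φ, hinj, hφO, hφb, hφ, hrange⟩ := h₀.exists_embedding h hcard₀
      (fun v hv => h.encard_childSet hv hd (hTdeg v)) ha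
    refine (iInf₂_le _ (hp.extend hinj)).trans ?_
    rw [JV_extend hinj, add_right_comm]
    gcongr
    refine (IE_extend_le hd h₀ h hinj (by rw [hφO, ha.2]) hφb hφ hrange hr₀ hdeg₀ hdeg
      hp).trans ?_
    gcongr
    · linarith
    · linarith
end

section
/- Let d ∈ ℕ with d ≥ 2, let S ⊆ ℕ satisfy d ∈ S and s ≥ d for every s ∈ S, and let ρ ≥ 1/((d−1)·log(d+1)). Then for every infinite, locally finite tree T all of whose vertex degrees lie in S, and every infinite tree T' all of whose vertex degrees equal d, one has χ_T(ρ) ≥ χ_{T'}(ρ). Consequently, the infimum of χ_T(ρ) over all infinite locally finite trees T with all degrees in S equals χ_{𝒯_d}(ρ), the value for the infinite d-regular tree. -/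
open scoped ENNReal BigOperators

section Helpers

open Finset Real

theorem SimpleGraph.IsAcyclic.eq_of_adj_of_walk_avoiding {V : Type*} {G : SimpleGraph V}
    (hG : G.IsAcyclic) {v y z : V} (hy : G.Adj v y) (hz : G.Adj v z) (p : G.Walk y z)
    (hp : v ∉ p.support) : y = z := by
  classical
  by_contra hne
  have hq : ((SimpleGraph.Walk.nil' z).cons hz |>.cons hy.symm).IsPath := by
    simp [SimpleGraph.Walk.cons_isPath_iff, hy.ne', hz.ne, hne]
  have h := (hG.subsingleton_path y z).elim ⟨_, hq⟩ ⟨p.bypass, p.bypass_isPath⟩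
  apply hp
  apply p.support_bypass_subset_support
  have h' := congrArg (fun q : G.Path y z => q.1.support) h
  simp only at h'
  rw [← h']
  simp

/-- The sum of `a z * a w` over ordered pairs of adjacent vertices in `A`. -/
noncomputable def adjSum {V : Type*} (G : SimpleGraph V) (A : Finset V) (a : V → ℝ) : ℝ :=
  open Classical in ∑ z ∈ A, ∑ w ∈ A, if G.Adj z w then a z * a w else 0

/-- The functional `I + ρ J` of a finitely supported measure with degrees replaced by
the weights `D`, made homogeneous of degree one. -/
noncomputable def freeEnergy {V : Type*} (G : SimpleGraph V) (ρ : ℝ) (A : Finset V)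
    (D : V → ℕ) (p : V → ℝ) : ℝ :=
  ∑ z ∈ A, p z - adjSum G A (fun z => √(p z / D z)) +
    ρ * (∑ z ∈ A, negMulLog (p z) - negMulLog (∑ z ∈ A, p z))

theorem add_mul_log_add_le {a b c r : ℝ} (ha : 0 ≤ a) (hb : 0 ≤ b) (hc : 0 ≤ c)
    (hcr : c ≤ r * b) :
    (a + c) * log (a + c) ≤ (a + c) * log (a + b) + c * log r := by
  rcases hc.eq_or_lt with rfl | hc
  · rcases ha.eq_or_lt with rfl | ha
    · simp
    · have : log a ≤ log (a + b) := log_le_log ha (by linarith)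
      simpa using mul_le_mul_of_nonneg_left this ha.le
  have hb : 0 < b := hb.lt_of_ne (by rintro rfl; simp at hcr; linarith)
  have h1 : log (a + c) - log (a + b) ≤ (a + c) / (a + b) - 1 := by
    rw [← log_div (by positivity) (by positivity)]
    exact log_le_sub_one_of_pos (by positivity)
  have h2 : log (a + c) - log (a + b) + (log b - log c) ≤ (a + c) / (a + b) * (b / c) - 1 := by
    rw [← log_div (by positivity) (by positivity), ← log_div (by positivity) (by positivity),
      ← log_mul (by positivity) (by positivity)]
    exact log_le_sub_one_of_pos (by positivity)
  have h3 : log c - log b ≤ log r := by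
    rw [← log_div (by positivity) (by positivity)]
    exact log_le_log (by positivity) (by rwa [div_le_iff₀ hb])
  have h4 : a * ((a + c) / (a + b) - 1) + c * ((a + c) / (a + b) * (b / c) - 1) = 0 := by
    field_simp
    ring
  have h5 := mul_le_mul_of_nonneg_left h1 ha
  have h6 := mul_le_mul_of_nonneg_left h2 hc.le
  have h7 := mul_le_mul_of_nonneg_left h3 hc.le
  nlinarith

theorem adjSum_mono {V : Type*} (G : SimpleGraph V) (A : Finset V) {a b : V → ℝ}
    (ha : ∀ z, 0 ≤ a z) (hab : ∀ z, a z ≤ b z) : adjSum G A a ≤ adjSum G A b := by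
  classical
  unfold adjSum
  refine sum_le_sum fun z _ => sum_le_sum fun w _ => ?_
  split_ifs
  · exact mul_le_mul (hab z) (hab w) (ha w) ((ha z).trans (hab z))
  · exact le_rfl

theorem freeEnergy_anti {V : Type*} (G : SimpleGraph V) (ρ : ℝ) (A : Finset V) {D D' : V → ℕ}
    (hD' : ∀ z, 0 < D' z) (hD : ∀ z, D' z ≤ D z) {p : V → ℝ} (hp : ∀ z, 0 ≤ p z) :
    freeEnergy G ρ A D p ≥ freeEnergy G ρ A D' p := by
  have := adjSum_mono G A (a := fun z => √(p z / D z)) (b := fun z => √(p z / D' z))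
    (fun z => sqrt_nonneg _) (fun z => sqrt_le_sqrt
      (div_le_div_of_nonneg_left (hp z) (by exact_mod_cast hD' z) (by exact_mod_cast hD z)))
  unfold freeEnergy
  linarith

theorem freeEnergy_subset {V : Type*} (G : SimpleGraph V) (ρ : ℝ) {A B : Finset V} (hBA : B ⊆ A)
    (D : V → ℕ) {p : V → ℝ} (hp : ∀ z ∈ A, z ∉ B → p z = 0) :
    freeEnergy G ρ B D p = freeEnergy G ρ A D p := by
  classical
  have h : adjSum G B (fun z => √(p z / D z)) = adjSum G A (fun z => √(p z / D z)) := by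
    unfold adjSum
    trans ∑ z ∈ B, ∑ w ∈ A, if G.Adj z w then √(p z / D z) * √(p w / D w) else 0
    · refine sum_congr rfl fun z _ => sum_subset hBA fun w hw hwB => ?_
      simp [hp w hw hwB]
    · refine sum_subset hBA fun z hz hzB => ?_
      simp [hp z hz hzB]
  unfold freeEnergy
  rw [h, sum_subset hBA hp, sum_subset hBA fun z hz hzB => by simp [hp z hz hzB]]

/-- A system of branches at `x`, indexed by `N`: the multiplier `κ y` vanishes on the branch `y`,
equals `r` on the other branches, and equals `1` outside the union `U` of the branches. -/
structure IsBranchMultiplier {V : Type*} (G : SimpleGraph V) (x : V) (N : Finset V) (U : Set V)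
    (r : ℝ) (κ : V → V → ℝ) : Prop where
  root : x ∉ U
  off : ∀ z ∉ U, ∀ y ∈ N, κ y z = 1
  on : ∀ z ∈ U, ∃ y₀ ∈ N, κ y₀ z = 0 ∧ ∀ y ∈ N, y ≠ y₀ → κ y z = r
  adj : ∀ z w, z ≠ x → w ≠ x → G.Adj z w → ∀ y ∈ N, κ y z = κ y w

namespace IsBranchMultiplier

variable {V : Type*} {G : SimpleGraph V} {x : V} {N : Finset V} {U : Set V} {r : ℝ}
  {κ : V → V → ℝ}

theorem sum_comp (h : IsBranchMultiplier G x N U r κ) (f : ℝ → ℝ) {z : V} (hz : z ∈ U) :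
    ∑ y ∈ N, f (κ y z) = f 0 + ((#N : ℝ) - 1) * f r := by
  classical
  obtain ⟨y₀, hy₀, h0, hr⟩ := h.on z hz
  rw [← add_sum_erase _ _ hy₀, h0, sum_congr rfl (g := fun _ => f r)]
  · rw [sum_const, card_erase_of_mem hy₀, nsmul_eq_mul, Nat.cast_sub (card_pos.2 ⟨_, hy₀⟩)]
    simp
  · intro y hy
    rw [hr y (mem_of_mem_erase hy) (ne_of_mem_erase hy)]

theorem sum_eq (h : IsBranchMultiplier G x N U r κ) (hr : ((#N : ℝ) - 1) * r = #N) (z : V) :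
    ∑ y ∈ N, κ y z = #N := by
  by_cases hz : z ∈ U
  · simpa [hr] using h.sum_comp (fun t => t) hz
  · rw [sum_congr rfl (h.off z hz)]
    simp

theorem eq_zero_or_eq_or_eq_one (h : IsBranchMultiplier G x N U r κ) (z : V) {y : V} (hy : y ∈ N) :
    z ∈ U ∧ κ y z = 0 ∨ z ∈ U ∧ κ y z = r ∨ z ∉ U ∧ κ y z = 1 := by
  by_cases hz : z ∈ U
  · obtain ⟨y₀, hy₀, h0, hr⟩ := h.on z hz
    by_cases e : y = y₀
    · subst e; simp [hz, h0]
    · simp [hz, hr y hy e]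
  · simp [hz, h.off z hz y hy]

theorem sum_negMulLog_mul (h : IsBranchMultiplier G x N U r κ) (hr : ((#N : ℝ) - 1) * r = #N)
    (t : ℝ) {z : V} (hz : z ∈ U) :
    ∑ y ∈ N, negMulLog (κ y z * t) = #N * negMulLog t - #N * log r * t := by
  simp only [negMulLog_mul, sum_add_distrib]
  rw [← mul_sum, ← sum_mul, h.sum_eq hr, h.sum_comp negMulLog hz]
  simp only [negMulLog, neg_zero, zero_mul, zero_add]
  linear_combination -(t * log r) * hr

theorem sum_edge (h : IsBranchMultiplier G x N U r κ) (hN : 2 ≤ #N)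
    (hr : ((#N : ℝ) - 1) * r = #N) {D D' : V → ℕ} (hD : ∀ z, z ≠ x → D' z = D z)
    (hDx : D x = #N) (hDx' : D' x = #N - 1) {p : V → ℝ}
    {A : Finset V} (hxU : ∀ w ∈ A, G.Adj x w → p w ≠ 0 → w ∈ U) {z w : V} (hzA : z ∈ A)
    (hwA : w ∈ A) (hzw : G.Adj z w) :
    ∑ y ∈ N, √(κ y z * p z / D' z) * √(κ y w * p w / D' w) =
      #N * (√(p z / D z) * √(p w / D w)) := by
  have hN' : (0 : ℝ) < #N - 1 := by
    have : (2 : ℝ) ≤ #N := by exact_mod_cast hN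
    linarith
  have hr0 : 0 < r := by
    by_contra! hr0
    have := mul_nonpos_of_nonneg_of_nonpos hN'.le hr0
    linarith
  have h0 : ∀ z, ∀ y ∈ N, 0 ≤ κ y z := fun z y hy => by
    rcases h.eq_zero_or_eq_or_eq_one z hy with h | h | h <;> simp [h.2, hr0.le]
  have key : ∀ w ∈ A, G.Adj x w → ∀ y ∈ N, √(κ y x * p x / D' x) * √(κ y w * p w / D' w) =
      κ y w * (√(p x / D x) * √(p w / D w)) := by
    intro w hwA hw y hy
    rw [h.off x h.root y hy, hDx, hDx', hD w hw.ne', one_mul]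
    by_cases hpw : p w = 0
    · simp [hpw]
    have hwU := hxU w hwA hw hpw
    rcases h.eq_zero_or_eq_or_eq_one w hy with h | h | h
    · simp [h.2]
    · rw [h.2, Nat.cast_sub (by omega), Nat.cast_one]
      have e1 : p x / ((#N : ℝ) - 1) = r * (p x / #N) := by
        rw [mul_div_assoc', div_eq_div_iff hN'.ne' (by linarith)]
        linear_combination -p x * hr
      rw [e1, sqrt_mul hr0.le, mul_div_assoc, sqrt_mul hr0.le]
      linear_combination (√(p x / #N) * √(p w / D w)) * mul_self_sqrt hr0.le
    · exact absurd hwU h.1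
  have hsum : ∀ v, (∀ y ∈ N, √(κ y z * p z / D' z) * √(κ y w * p w / D' w) =
      κ y v * (√(p z / D z) * √(p w / D w))) →
      ∑ y ∈ N, √(κ y z * p z / D' z) * √(κ y w * p w / D' w) =
      #N * (√(p z / D z) * √(p w / D w)) := by
    intro v hv
    rw [sum_congr rfl hv, ← sum_mul, h.sum_eq hr]
  by_cases hz : z = x
  · subst hz
    exact hsum w (key w hwA hzw)
  by_cases hw : w = x
  · subst hw
    refine hsum z fun y hy => ?_
    rw [mul_comm, key z hzA hzw.symm y hy]
    ring
  · refine hsum z fun y hy => ?_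
    rw [hD z hz, hD w hw, ← h.adj z w hz hw hzw y hy, mul_div_assoc, mul_div_assoc,
      sqrt_mul (h0 z y hy), sqrt_mul (h0 z y hy)]
    linear_combination (√(p z / D z) * √(p w / D w)) * mul_self_sqrt (h0 z y hy)

theorem sum_freeEnergy_le (h : IsBranchMultiplier G x N U r κ) (hN : 2 ≤ #N)
    (hr : ((#N : ℝ) - 1) * r = #N) {D D' : V → ℕ} (hD : ∀ z, z ≠ x → D' z = D z)
    (hDx : D x = #N) (hDx' : D' x = #N - 1) {p : V → ℝ} (hp : ∀ z, 0 ≤ p z)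
    {A : Finset V} (hxU : ∀ w ∈ A, G.Adj x w → p w ≠ 0 → w ∈ U) {ρ : ℝ} (hρ : 0 ≤ ρ) :
    ∑ y ∈ N, freeEnergy G ρ A D' (fun z => κ y z * p z) ≤ #N * freeEnergy G ρ A D p := by
  classical
  have hr0 : 0 < r := by
    have hN' : (2 : ℝ) ≤ #N := by exact_mod_cast hN
    by_contra! hr0
    have := mul_nonpos_of_nonneg_of_nonpos (by linarith : (0 : ℝ) ≤ #N - 1) hr0
    linarith
  have hmass : ∑ y ∈ N, ∑ z ∈ A, κ y z * p z = #N * ∑ z ∈ A, p z := by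
    rw [sum_comm, mul_sum]
    exact sum_congr rfl fun z _ => by rw [← sum_mul, h.sum_eq hr]
  have hadj : ∑ y ∈ N, adjSum G A (fun z => √(κ y z * p z / D' z)) =
      #N * adjSum G A (fun z => √(p z / D z)) := by
    unfold adjSum
    rw [sum_comm, mul_sum]
    refine sum_congr rfl fun z hz => ?_
    rw [sum_comm, mul_sum]
    refine sum_congr rfl fun w hw => ?_
    split_ifs with hzw
    · exact h.sum_edge hN hr hD hDx hDx' hxU hz hw hzw
    · simp
  set b := ∑ z ∈ A with z ∈ U, p z with hb
  set a := ∑ z ∈ A with z ∉ U, p z with ha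
  have hab : ∑ z ∈ A, p z = a + b := by
    rw [add_comm, hb, ha, sum_filter_add_sum_filter_not]
  have hent : ∑ y ∈ N, ∑ z ∈ A, negMulLog (κ y z * p z) =
      #N * ∑ z ∈ A, negMulLog (p z) - #N * log r * b := by
    rw [sum_comm, hb, sum_filter, mul_sum, mul_sum, ← sum_sub_distrib]
    refine sum_congr rfl fun z _ => ?_
    split_ifs with hz
    · exact h.sum_negMulLog_mul hr _ hz
    · rw [sum_congr rfl fun y hy => by rw [h.off z hz y hy, one_mul]]
      simp
  have hpart : ∀ y ∈ N, -negMulLog (∑ z ∈ A, κ y z * p z) ≤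
      (∑ z ∈ A, κ y z * p z) * log (a + b) + (∑ z ∈ A, κ y z * p z - a) * log r := by
    intro y hy
    have e : ∑ z ∈ A, κ y z * p z = a + ∑ z ∈ A with z ∈ U, κ y z * p z := by
      rw [← sum_filter_add_sum_filter_not A (· ∈ U), add_comm, ha]
      congr 1
      exact sum_congr rfl fun z hz => by rw [h.off z (mem_filter.1 hz).2 y hy, one_mul]
    have hκ : ∀ z ∈ A.filter (· ∈ U), 0 ≤ κ y z ∧ κ y z ≤ r := fun z hz => by
      rcases h.eq_zero_or_eq_or_eq_one z hy with h | h | h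
      · rw [h.2]; exact ⟨le_rfl, hr0.le⟩
      · rw [h.2]; exact ⟨hr0.le, le_rfl⟩
      · exact absurd (mem_filter.1 hz).2 h.1
    have := add_mul_log_add_le (a := a) (b := b) (c := ∑ z ∈ A with z ∈ U, κ y z * p z) (r := r)
      (sum_nonneg fun z _ => hp z) (sum_nonneg fun z _ => hp z)
      (sum_nonneg fun z hz => mul_nonneg (hκ z hz).1 (hp z)) (by
        rw [hb, mul_sum]
        exact sum_le_sum fun z hz => mul_le_mul_of_nonneg_right (hκ z hz).2 (hp z))
    rw [e, negMulLog]
    linarith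
  have hpart' := sum_le_sum hpart
  rw [sum_add_distrib, ← sum_mul, ← sum_mul, sum_sub_distrib, hmass, hab, sum_neg_distrib,
    sum_const, nsmul_eq_mul] at hpart'
  unfold freeEnergy
  rw [sum_add_distrib, sum_sub_distrib, ← mul_sum, sum_sub_distrib, hmass, hadj, hent, hab]
  have : negMulLog (a + b) = -((a + b) * log (a + b)) := by rw [negMulLog]; ring
  rw [this]
  have := mul_le_mul_of_nonneg_left hpart' hρ
  linarith

end IsBranchMultiplier

/-- `z` is reached from `y` by a walk avoiding `x`. -/
def InBranch {V : Type*} (G : SimpleGraph V) (x y z : V) : Prop :=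
  ∃ q : G.Walk y z, x ∉ q.support

theorem InBranch.eq {V : Type*} {G : SimpleGraph V} (hG : G.IsAcyclic) {x y y' z : V}
    (hy : G.Adj x y) (hy' : G.Adj x y') (h : InBranch G x y z) (h' : InBranch G x y' z) :
    y = y' := by
  obtain ⟨q, hq⟩ := h
  obtain ⟨q', hq'⟩ := h'
  refine hG.eq_of_adj_of_walk_avoiding hy hy' (q.append q'.reverse) ?_
  simp [SimpleGraph.Walk.mem_support_append_iff, hq, hq']

theorem InBranch.adj {V : Type*} {G : SimpleGraph V} {x y z w : V} (h : InBranch G x y z)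
    (hzw : G.Adj z w) (hw : w ≠ x) : InBranch G x y w := by
  obtain ⟨q, hq⟩ := h
  refine ⟨q.concat hzw, ?_⟩
  simp [SimpleGraph.Walk.support_concat, hq, hw.symm]

open Classical in
theorem isBranchMultiplier_inBranch {V : Type*} {G : SimpleGraph V} (hG : G.IsAcyclic) {x : V}
    {N : Finset V} (hN : ∀ y ∈ N, G.Adj x y) (r : ℝ) :
    IsBranchMultiplier G x N {z | ∃ y ∈ N, InBranch G x y z} r
      (fun y z => if InBranch G x y z then 0 else if ∃ y ∈ N, InBranch G x y z then r else 1) where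
  root := by
    rintro ⟨y, -, q, hq⟩
    exact hq q.end_mem_support
  off z hz y hy := by
    have hz' : ¬∃ y ∈ N, InBranch G x y z := hz
    rw [if_neg fun h => hz' ⟨y, hy, h⟩, if_neg hz']
  on z hz := by
    obtain ⟨y₀, hy₀, h⟩ := id hz
    refine ⟨y₀, hy₀, if_pos h, fun y hy hne => ?_⟩
    rw [if_neg fun h' => hne (h'.eq hG (hN y hy) (hN y₀ hy₀) h)]
    exact if_pos hz
  adj z w hz hw hzw y hy := by
    have key : ∀ y, InBranch G x y z ↔ InBranch G x y w := fun y =>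
      ⟨fun h => h.adj hzw hw, fun h => h.adj hzw.symm hz⟩
    simp only [key]

open Classical in
/-- Lower bounds for the free energy with constant weight `d` extend to weights at least `d`. -/
theorem le_freeEnergy_of_le {V : Type*} {G : SimpleGraph V} (hG : G.IsAcyclic) {ρ : ℝ}
    (hρ : 0 ≤ ρ) {d : ℕ} (hd : 1 ≤ d) {c : ℝ} (A : Finset V)
    (hc : ∀ p : V → ℝ, (∀ z, 0 ≤ p z) → (∀ x ∈ A, #{w ∈ A | G.Adj x w ∧ p w ≠ 0} ≤ d) →
      c * ∑ z ∈ A, p z ≤ freeEnergy G ρ A (fun _ => d) p) :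
    ∀ (D : V → ℕ) (p : V → ℝ), (∀ z, 0 ≤ p z) → (∀ z, d ≤ D z) →
      (∀ x ∈ A, #{w ∈ A | G.Adj x w ∧ p w ≠ 0} ≤ D x) →
      c * ∑ z ∈ A, p z ≤ freeEnergy G ρ A D p := by
  intro D
  induction hn : ∑ z ∈ A, D z using Nat.strong_induction_on generalizing D with
  | _ n ih =>
  intro p hp hdD hdeg
  by_cases hall : ∀ x ∈ A, D x = d
  · refine (hc p hp fun x hx => (hdeg x hx).trans (hall x hx).le).trans_eq ?_
    have : adjSum G A (fun z => √(p z / d)) = adjSum G A (fun z => √(p z / D z)) :=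
      sum_congr rfl fun z hz => sum_congr rfl fun w hw => by simp only [hall z hz, hall w hw]
    unfold freeEnergy
    rw [this]
  push Not at hall
  obtain ⟨x, hxA, hxd⟩ := hall
  have hlt : d < D x := lt_of_le_of_ne (hdD x) hxd.symm
  set D' := Function.update D x (D x - 1) with hD'
  have hD'x : D' x = D x - 1 := by simp [hD']
  have hD'z : ∀ z, z ≠ x → D' z = D z := fun z hz => by simp [hD', hz]
  have hD'd : ∀ z, d ≤ D' z := fun z => by
    by_cases hz : z = x
    · subst hz; omega
    · rw [hD'z z hz]; exact hdD z
  have hD'D : ∀ z, D' z ≤ D z := fun z => by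
    by_cases hz : z = x
    · subst hz; omega
    · rw [hD'z z hz]
  have hsum : ∑ z ∈ A, D' z < n := by
    rw [← hn]
    exact sum_lt_sum (fun z _ => hD'D z) ⟨x, hxA, by omega⟩
  set N := A.filter (fun w => G.Adj x w ∧ p w ≠ 0) with hNdef
  rcases (hdeg x hxA).lt_or_eq with hNlt | hNeq
  · refine (ih _ hsum D' rfl p hp hD'd fun z hz => ?_).trans
      (freeEnergy_anti G ρ A (fun z => hd.trans (hD'd z)) hD'D hp)
    by_cases hzx : z = x
    · subst hzx; rw [hD'x]; exact Nat.le_sub_one_of_lt hNlt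
    · rw [hD'z z hzx]; exact hdeg z hz
  · rw [← hNdef] at hNeq
    have hN2 : 2 ≤ #N := by omega
    have hN2' : (2 : ℝ) ≤ #N := by exact_mod_cast hN2
    have hr : ((#N : ℝ) - 1) * (#N / (#N - 1)) = #N := mul_div_cancel₀ _ (by linarith)
    have hB := isBranchMultiplier_inBranch hG (x := x) (N := N)
      (fun y hy => (mem_filter.1 hy).2.1) (#N / (#N - 1))
    set κ : V → V → ℝ := fun y z =>
      if InBranch G x y z then 0 else if ∃ y ∈ N, InBranch G x y z then (#N / (#N - 1)) else 1
      with hκ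
    have hκ0 : ∀ y z, 0 ≤ κ y z := fun y z => by
      simp only [hκ]
      split_ifs
      exacts [le_rfl, div_nonneg (by linarith) (by linarith), zero_le_one]
    have hstep : ∀ y ∈ N, c * ∑ z ∈ A, κ y z * p z ≤
        freeEnergy G ρ A D' (fun z => κ y z * p z) := by
      intro y hy
      refine ih _ hsum D' rfl _ (fun z => mul_nonneg (hκ0 y z) (hp z)) hD'd fun z hz => ?_
      have hsub : ∀ z, A.filter (fun w => G.Adj z w ∧ κ y w * p w ≠ 0) ⊆
          A.filter (fun w => G.Adj z w ∧ p w ≠ 0) := fun z =>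
        monotone_filter_right _ fun w _ hw => ⟨hw.1, right_ne_zero_of_mul hw.2⟩
      by_cases hzx : z = x
      · subst hzx
        rw [hD'x, ← hNeq, ← card_erase_of_mem hy]
        refine card_le_card fun w hw => mem_erase.2 ⟨?_, hsub z hw⟩
        rintro rfl
        refine left_ne_zero_of_mul (mem_filter.1 hw).2.2 (if_pos ⟨.nil, ?_⟩)
        simpa using (mem_filter.1 hy).2.1.ne
      · rw [hD'z z hzx]
        exact (card_le_card (hsub z)).trans (hdeg z hz)
    have h1 := (sum_le_sum hstep).trans
      (hB.sum_freeEnergy_le hN2 hr hD'z hNeq.symm (by omega) hp ?_ hρ)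
    · have hmass : ∑ y ∈ N, ∑ z ∈ A, κ y z * p z = #N * ∑ z ∈ A, p z := by
        rw [sum_comm, mul_sum]
        exact sum_congr rfl fun z _ => by rw [← sum_mul, hB.sum_eq hr]
      rw [← mul_sum, hmass, mul_left_comm] at h1
      exact le_of_mul_le_mul_left h1 (by linarith)
    · intro w hw hxw hpw
      refine ⟨w, mem_filter.2 ⟨hw, hxw, hpw⟩, .nil, ?_⟩
      simpa using hxw.ne

theorem SimpleGraph.IsAcyclic.eq_of_adj_of_induce_preconnected {V : Type*} {G : SimpleGraph V}
    (hG : G.IsAcyclic) {s : Set V} (hs : (G.induce s).Preconnected) {v y z : V} (hv : v ∉ s)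
    (hy : y ∈ s) (hz : z ∈ s) (hvy : G.Adj v y) (hvz : G.Adj v z) : y = z := by
  obtain ⟨q⟩ := hs ⟨y, hy⟩ ⟨z, hz⟩
  let q' : G.Walk y z := q.map (SimpleGraph.Embedding.induce s).toHom
  refine hG.eq_of_adj_of_walk_avoiding hvy hvz q' fun h => hv ?_
  have h' : v ∈ (q.map (SimpleGraph.Embedding.induce s).toHom).support := h
  rw [SimpleGraph.Walk.support_map, List.mem_map] at h'
  obtain ⟨u, -, rfl⟩ := h'
  exact u.2

theorem SimpleGraph.induce_insert_preconnected {V : Type*} {G : SimpleGraph V} {s : Set V}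
    (hs : (G.induce s).Preconnected) {v z : V} (hz : z ∈ s) (hzv : G.Adj z v) :
    (G.induce (insert v s)).Preconnected := by
  have h := SimpleGraph.induce_union_connected hs
    (SimpleGraph.induce_pair_connected_of_adj hzv).preconnected ⟨z, hz, by simp⟩
  have e : s ∪ {z, v} = insert v s := by
    ext u; simp only [Set.mem_union, Set.mem_insert_iff, Set.mem_singleton_iff]
    constructor
    · rintro (h | rfl | rfl) <;> simp_all
    · rintro (rfl | h) <;> simp_all
  rw [e] at h
  exact h.preconnected

/-- `φ` identifies the connected induced subgraph of `G` on `B` with a connected induced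
subgraph of `H`. -/
structure IsTreeEmbedding {V V' : Type*} (G : SimpleGraph V) (H : SimpleGraph V') (B : Finset V)
    (φ : V → V') : Prop where
  injOn : Set.InjOn φ B
  adj_iff : ∀ z ∈ B, ∀ w ∈ B, H.Adj (φ z) (φ w) ↔ G.Adj z w
  preconnected : (G.induce (B : Set V)).Preconnected
  preconnected_image : (H.induce (φ '' B)).Preconnected

open Classical in
theorem IsTreeEmbedding.exists_insert {V V' : Type*} {G : SimpleGraph V} {H : SimpleGraph V'}
    (hG : G.IsAcyclic) (hH : H.IsAcyclic) {d : ℕ} (hHd : ∀ x, d ≤ (H.neighborSet x).ncard)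
    {A B : Finset V} (hBA : B ⊆ A) (hA : ∀ x ∈ A, #{w ∈ A | G.Adj x w} ≤ d)
    {φ : V → V'} (h : IsTreeEmbedding G H B φ) {z v : V} (hz : z ∈ B) (hv : v ∈ A) (hvB : v ∉ B)
    (hzv : G.Adj z v) : ∃ ψ, IsTreeEmbedding G H (insert v B) ψ := by
  have hcard : #{w ∈ B | G.Adj z w} < d := by
    refine lt_of_lt_of_le (card_lt_card ?_) (hA z (hBA hz))
    refine (filter_subset_filter _ hBA).ssubset_of_mem_notMem (a := v) ?_ ?_ <;> simp [hv, hzv, hvB]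
  obtain ⟨u, hu, hu'⟩ : ∃ u ∈ H.neighborSet (φ z), u ∉ (image φ {w ∈ B | G.Adj z w} : Set V') := by
    refine Set.exists_mem_notMem_of_ncard_lt_ncard ?_ (Finset.finite_toSet _)
    rw [Set.ncard_coe_finset]
    exact (card_image_le.trans_lt hcard).trans_le (hHd _)
  have huz : H.Adj (φ z) u := hu
  have huB : u ∉ φ '' B := by
    rintro ⟨w, hw, rfl⟩
    exact hu' (mem_coe.2 (mem_image_of_mem _ (mem_filter.2 ⟨hw, (h.adj_iff z hz w hw).1 hu⟩)))
  have hne : ∀ w ∈ B, w ≠ v := fun w hw e => hvB (e ▸ hw)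
  have hψ : ∀ w ∈ B, Function.update φ v u w = φ w := fun w hw => by simp [hne w hw]
  have himg : Function.update φ v u '' (insert v B : Finset V) = insert u (φ '' B) := by
    rw [coe_insert, Set.image_insert_eq, Function.update_self, Set.image_congr hψ]
  have key : ∀ w ∈ B, H.Adj u (φ w) ↔ G.Adj v w := fun w hw => by
    constructor
    · intro hadj
      have := hH.eq_of_adj_of_induce_preconnected h.preconnected_image huB
        ⟨w, hw, rfl⟩ ⟨z, hz, rfl⟩ hadj huz.symm
      rw [h.injOn hw hz this]
      exact hzv.symm
    · intro hadj
      rw [hG.eq_of_adj_of_induce_preconnected h.preconnected hvB hw hz hadj hzv.symm]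
      exact huz.symm
  refine ⟨Function.update φ v u, ?_, ?_, ?_, ?_⟩
  · rw [coe_insert, Set.injOn_insert (by simpa using hvB)]
    refine ⟨h.injOn.congr fun w hw => (hψ w hw).symm, ?_⟩
    rwa [Function.update_self, Set.image_congr hψ]
  · intro a ha b hb
    rcases mem_insert.1 ha with rfl | ha' <;> rcases mem_insert.1 hb with rfl | hb'
    · simp
    · rw [Function.update_self, hψ b hb', key b hb']
    · rw [Function.update_self, hψ a ha', H.adj_comm, G.adj_comm, key a ha']
    · rw [hψ a ha', hψ b hb', h.adj_iff a ha' b hb']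
  · rw [coe_insert]
    exact SimpleGraph.induce_insert_preconnected h.preconnected (mem_coe.2 hz) hzv
  · rw [himg]
    exact SimpleGraph.induce_insert_preconnected h.preconnected_image ⟨z, hz, rfl⟩ hu

open Classical in
theorem exists_isTreeEmbedding {V V' : Type*} [Nonempty V'] {G : SimpleGraph V}
    {H : SimpleGraph V'} (hG : G.IsAcyclic) (hH : H.IsAcyclic) {d : ℕ}
    (hHd : ∀ x, d ≤ (H.neighborSet x).ncard) {A : Finset V} (hne : A.Nonempty)
    (hA : ∀ x ∈ A, #{w ∈ A | G.Adj x w} ≤ d) :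
    ∃ B ⊆ A, B.Nonempty ∧ (∀ z ∈ B, ∀ w ∈ A, w ∉ B → ¬G.Adj z w) ∧
      ∃ φ : V → V', IsTreeEmbedding G H B φ := by
  obtain ⟨a, ha⟩ := hne
  obtain ⟨o⟩ := ‹Nonempty V'›
  have hbase : {a} ∈ {B ∈ A.powerset | B.Nonempty ∧ ∃ φ : V → V', IsTreeEmbedding G H B φ} := by
    refine mem_filter.2 ⟨by simpa using ha, by simp, fun _ => o, by simp, by simp, ?_, ?_⟩
    · rw [coe_singleton]
      exact SimpleGraph.Preconnected.of_subsingleton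
    · rw [coe_singleton, Set.image_singleton]
      exact SimpleGraph.Preconnected.of_subsingleton
  obtain ⟨B, hB, hmax⟩ := exists_max_image _ card ⟨_, hbase⟩
  obtain ⟨hBA, hBne, φ, hφ⟩ := mem_filter.1 hB
  rw [mem_powerset] at hBA
  refine ⟨B, hBA, hBne, fun z hz w hw hwB hadj => ?_, φ, hφ⟩
  have h := hφ.exists_insert hG hH hHd hBA hA hz hw hwB hadj
  have := hmax (insert w B) (mem_filter.2
    ⟨mem_powerset.2 (insert_subset hw hBA), insert_nonempty _ _, h⟩)
  rw [card_insert_of_notMem hwB] at this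
  omega

theorem negMulLog_add_le {a b : ℝ} (ha : 0 ≤ a) (hb : 0 ≤ b) :
    negMulLog (a + b) ≤ negMulLog a + negMulLog b := by
  have key : ∀ {a b : ℝ}, 0 ≤ a → 0 ≤ b → a * log a ≤ a * log (a + b) := fun {a b} ha hb => by
    rcases ha.eq_or_lt with rfl | ha
    · simp
    · exact mul_le_mul_of_nonneg_left (log_le_log ha (by linarith)) ha.le
  have h1 := key ha hb
  have h2 := key hb ha
  rw [add_comm b a] at h2
  simp only [negMulLog]
  linarith

theorem freeEnergy_add_le {V : Type*} [DecidableEq V] {G : SimpleGraph V} {ρ : ℝ} (hρ : 0 ≤ ρ)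
    {A B : Finset V}
    (hBA : B ⊆ A) (hadj : ∀ z ∈ B, ∀ w ∈ A, w ∉ B → ¬G.Adj z w) (D : V → ℕ) {p : V → ℝ}
    (hp : ∀ z, 0 ≤ p z) :
    freeEnergy G ρ B D p + freeEnergy G ρ (A \ B) D p ≤ freeEnergy G ρ A D p := by
  classical
  have hsum : ∀ f : V → ℝ, ∑ z ∈ A, f z = ∑ z ∈ B, f z + ∑ z ∈ A \ B, f z := fun f => by
    rw [add_comm, sum_sdiff hBA]
  have hE : ∀ a : V → ℝ, adjSum G A a = adjSum G B a + adjSum G (A \ B) a := fun a => by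
    unfold adjSum
    rw [hsum]
    congr 1 <;> refine sum_congr rfl fun z hz => ?_ <;> rw [hsum]
    · rw [add_eq_left]
      refine sum_eq_zero fun w hw => if_neg ?_
      exact hadj z hz w (mem_sdiff.1 hw).1 (mem_sdiff.1 hw).2
    · rw [add_eq_right]
      refine sum_eq_zero fun w hw => if_neg fun h => ?_
      exact hadj w hw z (mem_sdiff.1 hz).1 (mem_sdiff.1 hz).2 h.symm
  have h := mul_le_mul_of_nonneg_left (negMulLog_add_le (a := ∑ z ∈ B, p z)
    (b := ∑ z ∈ A \ B, p z) (sum_nonneg fun z _ => hp z) (sum_nonneg fun z _ => hp z)) hρ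
  unfold freeEnergy
  rw [hsum p, hsum fun z => negMulLog (p z), hE]
  linarith

open Classical in
theorem le_freeEnergy_of_isAcyclic {V V' : Type*} [Nonempty V'] {G : SimpleGraph V}
    {H : SimpleGraph V'} (hG : G.IsAcyclic) (hH : H.IsAcyclic) {d : ℕ}
    (hHd : ∀ x, d ≤ (H.neighborSet x).ncard) {ρ : ℝ} (hρ : 0 ≤ ρ) {c : ℝ}
    (hc : ∀ (A : Finset V') (q : V' → ℝ), (∀ x, 0 ≤ q x) →
      c * ∑ z ∈ A, q z ≤ freeEnergy H ρ A (fun _ => d) q)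
    {p : V → ℝ} (hp : ∀ z, 0 ≤ p z) (A : Finset V) (hA : ∀ x ∈ A, #{w ∈ A | G.Adj x w} ≤ d) :
    c * ∑ z ∈ A, p z ≤ freeEnergy G ρ A (fun _ => d) p := by
  induction A using Finset.strongInduction with
  | _ A ih =>
  rcases A.eq_empty_or_nonempty with rfl | hne
  · simp [freeEnergy, adjSum]
  obtain ⟨B, hBA, hBne, hadj, φ, hφ⟩ := exists_isTreeEmbedding hG hH hHd hne hA
  have h1 := ih (A \ B) (sdiff_ssubset hBA hBne) fun x hx =>
    (card_le_card (filter_subset_filter _ sdiff_subset)).trans (hA x (mem_sdiff.1 hx).1)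
  have h2 := freeEnergy_add_le hρ hBA hadj (fun _ => d) hp
  have : Nonempty V := ⟨hBne.choose⟩
  set q : V' → ℝ := fun x => p (Function.invFunOn φ B x) with hq
  have hqφ : ∀ z ∈ B, q (φ z) = p z := fun z hz => by
    simp only [hq, hφ.injOn.leftInvOn_invFunOn (mem_coe.2 hz)]
  have hsum : ∀ f : V' → ℝ, ∑ x ∈ B.image φ, f x = ∑ z ∈ B, f (φ z) := fun f =>
    sum_image hφ.injOn
  have h3 := hc (B.image φ) q fun x => hp _
  have h4 : freeEnergy H ρ (B.image φ) (fun _ => d) q = freeEnergy G ρ B (fun _ => d) p := by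
    have e : adjSum H (B.image φ) (fun z => √(q z / d)) = adjSum G B (fun z => √(p z / d)) := by
      unfold adjSum
      rw [hsum]
      refine sum_congr rfl fun z hz => ?_
      rw [hsum]
      refine sum_congr rfl fun w hw => ?_
      simp only [hφ.adj_iff z hz w hw, hqφ z hz, hqφ w hw]
    unfold freeEnergy
    rw [e, hsum, hsum, sum_congr rfl hqφ,
      sum_congr rfl fun z hz => show negMulLog (q (φ z)) = negMulLog (p z) by rw [hqφ z hz]]
  rw [h4, hsum, sum_congr rfl hqφ] at h3
  rw [← sum_sdiff hBA, mul_add]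
  linarith

theorem freeEnergy_smul {V : Type*} (G : SimpleGraph V) (ρ : ℝ) (A : Finset V) (D : V → ℕ)
    {t : ℝ} (ht : 0 ≤ t) (p : V → ℝ) :
    freeEnergy G ρ A D (fun z => t * p z) = t * freeEnergy G ρ A D p := by
  have hE : adjSum G A (fun z => √(t * p z / D z)) = t * adjSum G A (fun z => √(p z / D z)) := by
    unfold adjSum
    rw [mul_sum]
    refine sum_congr rfl fun z _ => ?_
    rw [mul_sum]
    refine sum_congr rfl fun w _ => ?_
    split_ifs
    · dsimp only
      rw [mul_div_assoc, mul_div_assoc, sqrt_mul ht, sqrt_mul ht]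
      linear_combination (√(p z / D z) * √(p w / D w)) * mul_self_sqrt ht
    · simp
  unfold freeEnergy
  rw [hE]
  simp only [negMulLog_mul, sum_add_distrib, ← mul_sum, ← sum_mul]
  ring

theorem tsum_edgeSet_eq_tsum_dart {V : Type*} (G : SimpleGraph V) (g : V → V → ℝ≥0∞) :
    ∑' e : G.edgeSet, Sym2.lift ⟨fun x y => g x y + g y x, fun _ _ => add_comm _ _⟩ e.1 =
      ∑' a : G.Dart, g a.fst a.snd := by
  classical
  let edge : G.Dart → G.edgeSet := fun a => ⟨a.edge, a.edge_mem⟩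
  rw [← (Equiv.sigmaFiberEquiv edge).tsum_eq, ENNReal.tsum_sigma']
  refine tsum_congr fun e => ?_
  obtain ⟨e, he⟩ := e
  induction e using Sym2.ind with
  | _ x y =>
  let a : G.Dart := ⟨(x, y), he⟩
  have hfib : {b : G.Dart | edge b = ⟨s(x, y), he⟩} = (({a, a.symm} : Finset G.Dart) : Set G.Dart) := by
    ext b
    have := SimpleGraph.dart_edge_eq_iff b a
    simp only [Set.mem_ofPred_eq, edge, Subtype.mk.injEq, coe_insert, coe_singleton,
      Set.mem_insert_iff, Set.mem_singleton_iff]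
    exact this
  have h1 : ∑' b : {b : G.Dart | edge b = ⟨s(x, y), he⟩}, g b.1.fst b.1.snd = g x y + g y x := by
    rw [hfib]
    refine (Finset.tsum_subtype {a, a.symm} fun b : G.Dart => g b.fst b.snd).trans ?_
    rw [sum_pair a.symm_ne.symm]
    rfl
  rw [Sym2.lift_mk]
  exact h1.symm

theorem tsum_dart_fst {V : Type*} (G : SimpleGraph V) (hG : ∀ x, (G.neighborSet x).Finite)
    (f : V → ℝ≥0∞) :
    ∑' a : G.Dart, f a.fst = ∑' x, ((G.neighborSet x).ncard : ℝ≥0∞) * f x := by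
  let e : (Σ x, G.neighborSet x) ≃ G.Dart :=
    { toFun := fun s => G.dartOfNeighborSet s.1 s.2
      invFun := fun a => ⟨a.fst, a.snd, a.adj⟩
      left_inv := fun _ => rfl
      right_inv := fun _ => rfl }
  rw [← e.tsum_eq, ENNReal.tsum_sigma']
  refine tsum_congr fun x => ?_
  have := (hG x).fintype
  have : ∀ w : G.neighborSet x, f (e ⟨x, w⟩).fst = f x := fun _ => rfl
  simp only [this]
  rw [tsum_fintype, sum_const, card_univ, nsmul_eq_mul, Set.ncard_eq_toFinset_card',
    Set.toFinset_card]

theorem IE_add_tsum_dart {V : Type*} {G : SimpleGraph V} (hG : ∀ x, (G.neighborSet x).Finite)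
    (hpos : ∀ x, 0 < (G.neighborSet x).ncard) {p : V → ℝ} (hp : IsProb p) :
    IE G p + ∑' a : G.Dart, ENNReal.ofReal (√(p a.fst / degR G a.fst) * √(p a.snd / degR G a.snd))
      = 1 := by
  have hdeg : ∀ x, 0 < degR G x := fun x => by unfold degR; exact_mod_cast hpos x
  set b : V → ℝ := fun x => √(p x / degR G x) with hb
  have hb0 : ∀ x, 0 ≤ b x := fun x => sqrt_nonneg _
  have hsq : ∑' a : G.Dart, ENNReal.ofReal (b a.fst ^ 2) = 1 := by
    rw [tsum_dart_fst G hG fun x => ENNReal.ofReal (b x ^ 2)]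
    have : ∀ x, ((G.neighborSet x).ncard : ℝ≥0∞) * ENNReal.ofReal (b x ^ 2) =
        ENNReal.ofReal (p x) := fun x => by
      rw [← ENNReal.ofReal_natCast, ← ENNReal.ofReal_mul (Nat.cast_nonneg _), hb]
      simp only
      rw [sq_sqrt (div_nonneg (hp.1 x) (hdeg x).le)]
      congr 1
      exact mul_div_cancel₀ _ (hdeg x).ne'
    simp only [this]
    rw [← ENNReal.ofReal_tsum_of_nonneg hp.1 hp.2.2.summable, hp.2.2.tsum_eq, ENNReal.ofReal_one]
  rw [← hsq, ← tsum_edgeSet_eq_tsum_dart G fun x y => ENNReal.ofReal (b x * b y),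
    ← tsum_edgeSet_eq_tsum_dart G fun x _ => ENNReal.ofReal (b x ^ 2), IE, ← ENNReal.tsum_add]
  refine tsum_congr fun e => ?_
  obtain ⟨e, he⟩ := e
  induction e using Sym2.ind with
  | _ x y =>
  simp only [Sym2.lift_mk]
  rw [← ENNReal.ofReal_add (mul_nonneg (hb0 _) (hb0 _)) (mul_nonneg (hb0 _) (hb0 _)),
    ← ENNReal.ofReal_add (sq_nonneg _) (by have := hb0 x; have := hb0 y; positivity),
    ← ENNReal.ofReal_add (sq_nonneg _) (sq_nonneg _)]
  congr 1
  simp only [hb]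
  ring

theorem adjSum_eq_sum_filter {V : Type*} (G : SimpleGraph V) (A : Finset V) (b : V → ℝ) :
    open Classical in
    adjSum G A b = ∑ z ∈ (A ×ˢ A).filter (fun z => G.Adj z.1 z.2), b z.1 * b z.2 := by
  rw [sum_filter, sum_product]
  rfl

theorem ofReal_adjSum_le_tsum_dart {V : Type*} (G : SimpleGraph V) (A : Finset V) {b : V → ℝ}
    (hb : ∀ x, 0 ≤ b x) :
    ENNReal.ofReal (adjSum G A b) ≤ ∑' a : G.Dart, ENNReal.ofReal (b a.fst * b a.snd) := by
  classical
  rw [adjSum_eq_sum_filter, ENNReal.ofReal_sum_of_nonneg fun _ _ => mul_nonneg (hb _) (hb _),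
    ← Finset.tsum_subtype]
  let i : (A ×ˢ A).filter (fun z => G.Adj z.1 z.2) → G.Dart := fun z => ⟨z.1, (mem_filter.1 z.2).2⟩
  have hi : Function.Injective i := fun z w h => Subtype.ext (congrArg SimpleGraph.Dart.toProd h)
  exact ENNReal.tsum_comp_le_tsum_of_injective hi
    fun a : G.Dart => ENNReal.ofReal (b a.fst * b a.snd)

theorem tsum_dart_le_of_adjSum_le {V : Type*} (G : SimpleGraph V) {b : V → ℝ}
    (hb : ∀ x, 0 ≤ b x) {C : ℝ} (hC : ∀ A, adjSum G A b ≤ C) :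
    ∑' a : G.Dart, ENNReal.ofReal (b a.fst * b a.snd) ≤ ENNReal.ofReal C := by
  classical
  rw [ENNReal.tsum_eq_iSup_sum]
  refine iSup_le fun F => ?_
  rw [← ENNReal.ofReal_sum_of_nonneg fun _ _ => mul_nonneg (hb _) (hb _)]
  refine ENNReal.ofReal_le_ofReal (le_trans ?_
    (hC (F.image (fun a => a.fst) ∪ F.image (fun a => a.snd))))
  rw [adjSum_eq_sum_filter, ← sum_image (s := F) (g := SimpleGraph.Dart.toProd)
    (f := fun z : V × V => b z.1 * b z.2) SimpleGraph.Dart.toProd_injective.injOn]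
  refine sum_le_sum_of_subset_of_nonneg ?_ fun _ _ _ => mul_nonneg (hb _) (hb _)
  intro z hz
  obtain ⟨a, ha, rfl⟩ := mem_image.1 hz
  exact mem_filter.2 ⟨mem_product.2 ⟨mem_union_left _ (mem_image_of_mem _ ha),
    mem_union_right _ (mem_image_of_mem _ ha)⟩, a.adj⟩

theorem chi_le_one {V : Type*} [Nonempty V] {G : SimpleGraph V}
    (hG : ∀ x, (G.neighborSet x).Finite) (hpos : ∀ x, 0 < (G.neighborSet x).ncard) (ρ : ℝ) :
    chi G ρ ≤ 1 := by
  classical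
  obtain ⟨o⟩ := ‹Nonempty V›
  have hp : IsProb (fun x : V => if x = o then (1 : ℝ) else 0) := by
    refine ⟨fun x => ?_, fun x => ?_, hasSum_ite_eq o 1⟩ <;> dsimp only <;> split_ifs <;> norm_num
  refine (iInf₂_le _ hp).trans ?_
  have hJ : JV (fun x : V => if x = o then (1 : ℝ) else 0) = 0 := by
    refine ENNReal.tsum_eq_zero.2 fun x => ?_
    dsimp only
    split_ifs <;> simp
  rw [hJ, mul_zero, add_zero]
  exact le_self_add.trans (IE_add_tsum_dart hG hpos hp).le

theorem chi_toReal_mul_le_freeEnergy {V : Type*} {G : SimpleGraph V}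
    (hG : ∀ x, (G.neighborSet x).Finite) {d : ℕ} (hd : 0 < d)
    (hGd : ∀ x, (G.neighborSet x).ncard = d) {ρ : ℝ} (hρ : 0 ≤ ρ) (A : Finset V) {q : V → ℝ}
    (hq : ∀ x, 0 ≤ q x) :
    (chi G ρ).toReal * ∑ z ∈ A, q z ≤ freeEnergy G ρ A (fun _ => d) q := by
  classical
  set M := ∑ z ∈ A, q z with hM
  have hM0 : 0 ≤ M := sum_nonneg fun z _ => hq z
  rcases hM0.eq_or_lt with h0 | h0
  · rw [← freeEnergy_subset G ρ (empty_subset A) _ fun z hz _ =>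
      (sum_eq_zero_iff_of_nonneg fun z _ => hq z).1 h0.symm z hz, ← h0]
    simp [freeEnergy, adjSum]
  set p : V → ℝ := fun z => if z ∈ A then M⁻¹ * q z else 0 with hp
  have hpA : ∀ z ∈ A, p z = M⁻¹ * q z := fun z hz => if_pos hz
  have hpn : ∀ z ∉ A, p z = 0 := fun z hz => if_neg hz
  have hsum : ∑ z ∈ A, p z = 1 := by
    rw [sum_congr rfl hpA, ← mul_sum]
    exact inv_mul_cancel₀ h0.ne'
  have hp0 : ∀ z, 0 ≤ p z := fun z => by
    simp only [hp]
    split_ifs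
    exacts [mul_nonneg (inv_nonneg.2 h0.le) (hq z), le_rfl]
  have hp1 : ∀ z, p z ≤ 1 := fun z => by
    by_cases hz : z ∈ A
    · exact (single_le_sum (fun z _ => hp0 z) hz).trans hsum.le
    · rw [hpn z hz]; exact zero_le_one
  have hprob : IsProb p := ⟨hp0, hp1, hsum ▸ hasSum_sum_of_ne_finset_zero hpn⟩
  have hE := IE_add_tsum_dart hG (fun x => (hGd x).symm ▸ hd) hprob
  have hE' := ofReal_adjSum_le_tsum_dart G A (b := fun z => √(p z / degR G z))
    fun z => sqrt_nonneg _
  have hJ : JV p = ENNReal.ofReal (∑ z ∈ A, negMulLog (p z)) := by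
    rw [ENNReal.ofReal_sum_of_nonneg fun z _ => negMulLog_nonneg (hp0 z) (hp1 z), JV,
      tsum_eq_sum (s := A) fun z hz => by simp [hpn z hz]]
    simp [negMulLog]
  have hIE : IE G p ≤ 1 := le_self_add.trans hE.le
  have hIE' : (IE G p).toReal ≤ 1 - adjSum G A (fun z => √(p z / degR G z)) := by
    have h := (add_le_add_right hE' (IE G p)).trans_eq hE
    have h' := ENNReal.toReal_mono ENNReal.one_ne_top h
    rw [ENNReal.toReal_add (ne_top_of_le_ne_top ENNReal.one_ne_top hIE) ENNReal.ofReal_ne_top,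
      ENNReal.toReal_one] at h'
    linarith [le_max_left (adjSum G A (fun z => √(p z / degR G z))) 0,
      ENNReal.toReal_ofReal' (r := adjSum G A (fun z => √(p z / degR G z)))]
  have hchi : (chi G ρ).toReal ≤ freeEnergy G ρ A (fun _ => d) p := by
    have h : chi G ρ ≤ IE G p + ENNReal.ofReal ρ * JV p := iInf₂_le _ hprob
    rw [hJ, ← ENNReal.ofReal_mul hρ] at h
    have h' := ENNReal.toReal_mono (ENNReal.add_ne_top.2
      ⟨ne_top_of_le_ne_top ENNReal.one_ne_top hIE, ENNReal.ofReal_ne_top⟩) h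
    rw [ENNReal.toReal_add (ne_top_of_le_ne_top ENNReal.one_ne_top hIE) ENNReal.ofReal_ne_top,
      ENNReal.toReal_ofReal (mul_nonneg hρ
        (sum_nonneg fun z _ => negMulLog_nonneg (hp0 z) (hp1 z)))] at h'
    have hdeg : ∀ z, degR G z = d := fun z => by rw [degR, hGd]
    simp only [hdeg] at hIE'
    unfold freeEnergy
    rw [hsum, negMulLog_one, sub_zero]
    linarith
  have hq' : ∀ z ∈ A, M * p z = q z := fun z hz => by
    rw [hpA z hz, mul_inv_cancel_left₀ h0.ne']
  have hF : freeEnergy G ρ A (fun _ => d) q = M * freeEnergy G ρ A (fun _ => d) p := by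
    rw [← freeEnergy_smul G ρ A _ h0.le]
    have e : adjSum G A (fun z => √(q z / d)) = adjSum G A (fun z => √(M * p z / d)) :=
      sum_congr rfl fun z hz => sum_congr rfl fun w hw => by simp only [hq' z hz, hq' w hw]
    unfold freeEnergy
    rw [e, sum_congr rfl hq',
      sum_congr rfl fun z hz => show negMulLog (M * p z) = negMulLog (q z) by rw [hq' z hz]]
  rw [hF, mul_comm]
  exact mul_le_mul_of_nonneg_left hchi h0.le

open Classical in
/-- Among infinite trees with degrees at least `d`, the `d`-regular one minimises `chi`. -/
theorem chi_regular_le {V V' : Type*} [Nonempty V'] {T : SimpleGraph V} {T' : SimpleGraph V'}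
    (hT : T.IsAcyclic) (hT' : T'.IsAcyclic) (hfin : ∀ x, (T.neighborSet x).Finite) {d : ℕ}
    (hd : 0 < d) (hTd : ∀ x, d ≤ (T.neighborSet x).ncard)
    (hT'd : ∀ x, (T'.neighborSet x).ncard = d) {ρ : ℝ} (hρ : 0 < ρ) :
    chi T' ρ ≤ chi T ρ := by
  have hfin' : ∀ x, (T'.neighborSet x).Finite := fun x =>
    Set.finite_of_ncard_pos (by rw [hT'd]; exact hd)
  have hchi1 := chi_le_one hfin' (fun x => (hT'd x).symm ▸ hd) ρ
  have hchi : chi T' ρ ≠ ⊤ := ne_top_of_le_ne_top ENNReal.one_ne_top hchi1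
  have hc1 : (chi T' ρ).toReal ≤ 1 := by
    simpa using ENNReal.toReal_mono ENNReal.one_ne_top hchi1
  refine le_iInf₂ fun p hp => ?_
  by_cases hJ : JV p = ⊤
  · rw [hJ, ENNReal.mul_top (by simpa using hρ), add_top]
    exact le_top
  have hIE1 := IE_add_tsum_dart hfin (fun x => hd.trans_le (hTd x)) hp
  have hIE : IE T p ≠ ⊤ := ne_top_of_le_ne_top ENNReal.one_ne_top (le_self_add.trans hIE1.le)
  have hbound : ∀ A, adjSum T A (fun z => √(p z / degR T z)) ≤
      1 - (chi T' ρ).toReal + ρ * (JV p).toReal := by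
    intro A
    have h := le_freeEnergy_of_le hT hρ.le hd A (c := (chi T' ρ).toReal) (fun q hq hA => by
      have hsub : A.filter (fun z => q z ≠ 0) ⊆ A := filter_subset _ _
      have hzero : ∀ z ∈ A, z ∉ A.filter (fun z => q z ≠ 0) → q z = 0 := fun z hz hz' => by
        by_contra h
        exact hz' (mem_filter.2 ⟨hz, h⟩)
      rw [← sum_subset hsub hzero, ← freeEnergy_subset T ρ hsub _ hzero]
      refine le_freeEnergy_of_isAcyclic hT hT' (fun x => (hT'd x).ge) hρ.le (fun B q' hq' =>
        chi_toReal_mul_le_freeEnergy hfin' hd hT'd hρ.le B hq') hq _ fun x hx => ?_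
      refine le_trans (card_le_card fun w hw => ?_) (hA x (hsub hx))
      simp only [mem_filter] at hw ⊢
      exact ⟨hw.1.1, hw.2, hw.1.2⟩) (fun x => (T.neighborSet x).ncard) p hp.1 hTd (fun x _ => by
        rw [← Set.ncard_coe_finset]
        exact Set.ncard_le_ncard (fun w hw => (mem_filter.1 (mem_coe.1 hw)).2.1) (hfin x))
    have hM0 : 0 ≤ ∑ z ∈ A, p z := sum_nonneg fun z _ => hp.1 z
    have hM1 : ∑ z ∈ A, p z ≤ 1 := sum_le_hasSum A (fun z _ => hp.1 z) hp.2.2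
    have hJA : ∑ z ∈ A, negMulLog (p z) ≤ (JV p).toReal := by
      rw [← ENNReal.ofReal_le_iff_le_toReal hJ,
        ENNReal.ofReal_sum_of_nonneg fun z _ => negMulLog_nonneg (hp.1 z) (hp.2.1 z)]
      simp only [negMulLog, neg_mul]
      exact ENNReal.sum_le_tsum A
    have h1 := mul_le_mul_of_nonneg_left hJA hρ.le
    have h2 := mul_nonneg hρ.le (negMulLog_nonneg hM0 hM1)
    have h3 := mul_le_mul_of_nonneg_left hM1 (sub_nonneg.2 hc1)
    unfold freeEnergy at h
    unfold degR
    linarith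
  have hC : 0 ≤ 1 - (chi T' ρ).toReal + ρ * (JV p).toReal :=
    add_nonneg (sub_nonneg.2 hc1) (mul_nonneg hρ.le ENNReal.toReal_nonneg)
  have hE := add_le_add_right (tsum_dart_le_of_adjSum_le T (fun z => sqrt_nonneg _) hbound) (IE T p)
  rw [hIE1] at hE
  have hE' := ENNReal.toReal_mono (ENNReal.add_ne_top.2 ⟨hIE, ENNReal.ofReal_ne_top⟩) hE
  rw [ENNReal.toReal_add hIE ENNReal.ofReal_ne_top, ENNReal.toReal_ofReal hC,
    ENNReal.toReal_one] at hE'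
  rw [← ENNReal.toReal_le_toReal hchi
    (ENNReal.add_ne_top.2 ⟨hIE, ENNReal.mul_ne_top ENNReal.ofReal_ne_top hJ⟩),
    ENNReal.toReal_add hIE (ENNReal.mul_ne_top ENNReal.ofReal_ne_top hJ), ENNReal.toReal_mul,
    ENNReal.toReal_ofReal hρ.le]
  linarith

end Helpers

/-- Minimal tree is optimal: for `ρ ≥ 1/((d−1) log(d+1))`, every
infinite locally finite tree with degrees in `S` (where `d = min S` in the sense
that `d ∈ S` and `d ≤ s` for all `s ∈ S`) has `χ` at least that of the infinite
`d`-regular tree; consequently the infimum over all such trees (on a fixed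
countable vertex set, which suffices since infinite locally finite connected
graphs are countable) is `χ_{𝒯_d}(ρ)`. -/
theorem chi_min_tree {d : ℕ} (hd : 2 ≤ d) (S : Set ℕ) (hdS : d ∈ S)
    (hS : ∀ s ∈ S, d ≤ s)
    (ρ : ℝ) (hρ : 1 / (((d : ℝ) - 1) * Real.log ((d : ℝ) + 1)) ≤ ρ) :
    (∀ {V : Type} (T : SimpleGraph V), Infinite V →
        (∀ x, (T.neighborSet x).Finite) → T.IsTree →
        (∀ x, (T.neighborSet x).ncard ∈ S) →
      ∀ {V' : Type} (T' : SimpleGraph V'), Infinite V' → T'.IsTree →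
        (∀ x, (T'.neighborSet x).ncard = d) →
        chi T' ρ ≤ chi T ρ) ∧
    (∀ T₀ : SimpleGraph ℕ, T₀.IsTree → (∀ x, (T₀.neighborSet x).ncard = d) →
      (⨅ (T : SimpleGraph ℕ) (_ : (∀ x, (T.neighborSet x).Finite) ∧ T.IsTree ∧
          ∀ x, (T.neighborSet x).ncard ∈ S), chi T ρ) = chi T₀ ρ) := by
  have hd1 : (1 : ℝ) < d := by exact_mod_cast hd
  have hρ0 : 0 < ρ := lt_of_lt_of_le
    (one_div_pos.2 (mul_pos (by linarith) (Real.log_pos (by linarith)))) hρ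
  have main : ∀ {V : Type} (T : SimpleGraph V), Infinite V →
      (∀ x, (T.neighborSet x).Finite) → T.IsTree → (∀ x, (T.neighborSet x).ncard ∈ S) →
      ∀ {V' : Type} (T' : SimpleGraph V'), Infinite V' → T'.IsTree →
        (∀ x, (T'.neighborSet x).ncard = d) → chi T' ρ ≤ chi T ρ := by
    intro V T _ hfin hT hTS V' T' _ hT' hT'd
    exact chi_regular_le hT.isAcyclic hT'.isAcyclic hfin (by omega) (fun x => hS _ (hTS x)) hT'd hρ0
  refine ⟨main, fun T₀ hT₀ hT₀d => le_antisymm ?_ ?_⟩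
  · exact iInf₂_le _ ⟨fun x => Set.finite_of_ncard_pos (by rw [hT₀d]; omega), hT₀,
      fun x => (hT₀d x).symm ▸ hdS⟩
  · exact le_iInf₂ fun T hT =>
      main T inferInstance hT.1 hT.2.1 hT.2.2 T₀ inferInstance hT₀ hT₀d
end

section
/- Let ρ > 0 and c ∈ ℝ, and suppose r : (0,∞) → ℝ satisfies, for all sufficiently large t, r(t) > e^e and ρ·t = r(t)·log(log r(t)) − c·r(t) + r(t)/log r(t). Then lim_{t → ∞} r(t)·log(log t) / (ρ·t) = 1. -/
open Filter

/-- The growth factor, in the variable `u = log r`, is asymptotic to `log u`. -/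
theorem tendsto_log_sub_add_inv_div_log (c : ℝ) :
    Tendsto (fun u => (Real.log u - c + 1 / u) / Real.log u) atTop (nhds 1) := by
  have h₁ : Tendsto (fun u : ℝ => 1 + (-c + 1 / u) * (Real.log u)⁻¹) atTop
      (nhds (1 + (-c + 0) * 0)) :=
    tendsto_const_nhds.add
      ((tendsto_const_nhds.add (tendsto_const_nhds.div_atTop tendsto_id)).mul
        Real.tendsto_log_atTop.inv_tendsto_atTop)
  rw [mul_zero, add_zero] at h₁
  refine h₁.congr' ?_
  filter_upwards [Real.tendsto_log_atTop.eventually_gt_atTop 0] with u hu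
  field_simp
  ring

theorem tendsto_log_log_div_id_atTop :
    Tendsto (fun u => Real.log (Real.log u) / u) atTop (nhds 0) :=
  ((Real.isLittleO_log_id_atTop.comp_tendsto Real.tendsto_log_atTop).trans
    Real.isLittleO_log_id_atTop).tendsto_div_nhds_zero

theorem tendsto_log_add_log_sub_div (c a : ℝ) :
    Tendsto (fun u => Real.log (u + Real.log (Real.log u - c + 1 / u) - a) /
      (Real.log u - c + 1 / u)) atTop (nhds 1) := by
  have hlog := Real.tendsto_log_atTop
  have hf := tendsto_log_sub_add_inv_div_log c
  have hlogf : Tendsto (fun u : ℝ => Real.log ((Real.log u - c + 1 / u) / Real.log u))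
      atTop (nhds 0) := by
    simpa using hf.log one_ne_zero
  have hq : Tendsto (fun u => (u + Real.log (Real.log u - c + 1 / u) - a) / u) atTop
      (nhds 1) := by
    have h₁ := ((tendsto_const_nhds (x := (1 : ℝ))).add
      ((hlogf.sub_const a).div_atTop tendsto_id)).add tendsto_log_log_div_id_atTop
    rw [add_zero, add_zero] at h₁
    refine h₁.congr' ?_
    filter_upwards [hlog.eventually_gt_atTop 0, eventually_gt_atTop 0,
      hf.eventually_const_lt zero_lt_one] with u hl hu hfu
    have hf0 : Real.log u - c + 1 / u ≠ 0 := fun h0 => hfu.ne' (by rw [h0, zero_div])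
    rw [Real.log_div hf0 hl.ne']
    simp only [id]
    field_simp
    ring
  have hlogq : Tendsto (fun u => Real.log ((u + Real.log (Real.log u - c + 1 / u) - a) / u))
      atTop (nhds 0) := by
    simpa using hq.log one_ne_zero
  have h₂ := ((tendsto_const_nhds (x := (1 : ℝ))).add (hlogq.div_atTop hlog)).div hf
    one_ne_zero
  rw [add_zero, div_one] at h₂
  refine h₂.congr' ?_
  filter_upwards [hlog.eventually_gt_atTop 0, eventually_gt_atTop 0,
    hq.eventually_const_lt zero_lt_one, hf.eventually_const_lt zero_lt_one] with u hl hu hqu hfu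
  have hq0 : u + Real.log (Real.log u - c + 1 / u) - a ≠ 0 := fun h0 => hqu.ne' (by rw [h0, zero_div])
  rw [Pi.div_apply, Real.log_div hq0 hu.ne', one_add_div hl.ne', add_sub_cancel,
    div_div_div_cancel_right₀ hl.ne']

theorem tendsto_atTop_of_mul_eq {ρ c : ℝ} (hρ : 0 < ρ) {r : ℝ → ℝ}
    (h : ∀ᶠ t in atTop, Real.exp (Real.exp 1) < r t ∧
      ρ * t = r t * Real.log (Real.log (r t)) - c * r t + r t / Real.log (r t)) :
    Tendsto r atTop atTop := by
  refine tendsto_atTop.2 fun M => ?_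
  filter_upwards [h, eventually_gt_atTop (M * (M + |c| + 1) / ρ)] with t ⟨hr, ht⟩ hM
  by_contra! hlt
  have hr0 : 0 < r t := (Real.exp_pos _).trans hr
  have hlog : Real.exp 1 < Real.log (r t) := (Real.lt_log_iff_exp_lt hr0).2 hr
  have he : 1 < Real.exp 1 := by simp
  have h₁ := Real.log_le_self hr0.le
  have h₂ := Real.log_le_self (zero_le_one.trans (he.trans hlog).le)
  have h₃ : 1 / Real.log (r t) ≤ 1 := by
    rw [div_le_one] <;> linarith
  have hle : ρ * t ≤ M * (M + |c| + 1) := by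
    calc ρ * t = r t * (Real.log (Real.log (r t)) - c + 1 / Real.log (r t)) := by rw [ht]; ring
      _ ≤ r t * (M + |c| + 1) := by
        gcongr
        linarith [neg_abs_le c]
      _ ≤ M * (M + |c| + 1) := by
        have hM0 := hr0.trans hlt
        gcongr
  rw [div_lt_iff₀ hρ] at hM
  linarith

/-- if, for all sufficiently large `t`, `r(t) > e^e` and
`ρ t = r(t) log(log r(t)) − c r(t) + r(t)/log r(t)`, then
`r(t) log(log t) / (ρ t) → 1` as `t → ∞`. -/
theorem optimal_radius_asymptotics (ρ : ℝ) (hρ : 0 < ρ) (c : ℝ) (r : ℝ → ℝ)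
    (h : ∀ᶠ t in atTop, Real.exp (Real.exp 1) < r t ∧
      ρ * t = r t * Real.log (Real.log (r t)) - c * r t + r t / Real.log (r t)) :
    Tendsto (fun t => r t * Real.log (Real.log t) / (ρ * t)) atTop (nhds 1) := by
  have hr := tendsto_atTop_of_mul_eq hρ h
  refine ((tendsto_log_add_log_sub_div c (Real.log ρ)).comp
    (Real.tendsto_log_atTop.comp hr)).congr' ?_
  filter_upwards [h, eventually_gt_atTop 0] with t ⟨hrt, ht⟩ ht0
  have hr0 : 0 < r t := (Real.exp_pos _).trans hrt
  simp only [Function.comp_apply]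
  set f := Real.log (Real.log (r t)) - c + 1 / Real.log (r t) with hf
  have hT : ρ * t = r t * f := by rw [ht, hf]; ring
  have hf0 : f ≠ 0 := fun h0 => by
    rw [h0, mul_zero] at hT
    exact (mul_pos hρ ht0).ne' hT
  have hlog : Real.log (r t) + Real.log f - Real.log ρ = Real.log t := by
    rw [← Real.log_mul hr0.ne' hf0, ← hT, Real.log_mul hρ.ne' ht0.ne', add_sub_cancel_left]
  rw [hlog, hT, mul_div_mul_left _ _ hr0.ne']
end

section
/- Let ρ > 0, θ > 0 and c ∈ ℝ. For t > 0 define F_{c,t}(r) := ρ·log(θ r) − (r/t)·( log(log(θ r)) − c ) for r > 0 with θ r ≥ e^e, and set 𝔯_t := ρ·t / log(log t). Then limsup_{t → ∞} [ sup{ F_{c,t}(r) : r > 0, θ r ≥ e^e } − ρ·log(θ·𝔯_t) + ρ ] ≤ 0. -/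
open Filter

/-- A real `limsup` is at most `0` as soon as `f` is eventually below every positive number;
no lower bound is needed, because the infimum of a set unbounded below is `0` by convention. -/
lemma limsup_nonpos_of_forall_pos {α : Type*} {l : Filter α} {f : α → ℝ}
    (h : ∀ ε > 0, ∀ᶠ x in l, f x ≤ ε) : limsup f l ≤ 0 := by
  rw [limsup_eq]
  by_cases hb : BddBelow {a | ∀ᶠ x in l, f x ≤ a}
  · exact le_of_forall_pos_le_add fun ε hε => by simpa using csInf_le hb (h ε hε)
  · rw [Real.sInf_of_not_bddBelow hb]

/-- Maximizing `log y - κ y` over `y > 0`. -/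
lemma log_add_one_sub_mul_le {y κ : ℝ} (hy : 0 < y) (hκ : 0 < κ) :
    Real.log y + 1 - y * κ ≤ -Real.log κ := by
  have h := Real.log_le_sub_one_of_pos (mul_pos hy hκ)
  rw [Real.log_mul hy.ne' hκ.ne'] at h
  linarith

lemma log_log_le_div_four_add {u : ℝ} (hu : 1 < u) :
    Real.log (Real.log u) ≤ u / 4 + Real.log 4 := by
  have h1 := Real.log_le_sub_one_of_pos (Real.log_pos hu)
  have h2 := Real.log_le_sub_one_of_pos (show 0 < u / 4 by linarith)
  rw [Real.log_div (by linarith) (by norm_num)] at h2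
  linarith

lemma one_le_log_log {x : ℝ} (hx : Real.exp (Real.exp 1) ≤ x) :
    1 ≤ Real.log (Real.log x) := by
  have hx0 : 0 < x := (Real.exp_pos _).trans_le hx
  have h := (Real.le_log_iff_exp_le hx0).2 hx
  exact (Real.le_log_iff_exp_le ((Real.exp_pos _).trans_le h)).2 h

/-- The bound in the range `log (θ r) ≤ (log t) / 2`. -/
lemma F_le_of_log_le {ρ θ c t r : ℝ} (hρ : 0 < ρ) (hθ : 0 < θ) (ht : 1 < t) (hr : 0 < r)
    (hx : Real.exp (Real.exp 1) ≤ θ * r) (hlog : Real.log (θ * r) ≤ Real.log t / 2) :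
    ρ * Real.log (θ * r) - (r / t) * (Real.log (Real.log (θ * r)) - c)
      ≤ ρ * (Real.log t / 2) + |c| / θ := by
  have ht0 : 0 < t := by linarith
  have hle : θ * r ≤ t :=
    (Real.log_le_log_iff (by positivity) ht0).1 (by linarith [Real.log_pos ht])
  have hrt : r / t ≤ 1 / θ := by
    rw [div_le_div_iff₀ ht0 hθ]
    linarith
  have hrt0 : 0 < r / t := div_pos hr ht0
  have h1 : ρ * Real.log (θ * r) ≤ ρ * (Real.log t / 2) := by gcongr
  have h2 : (r / t) * (c - Real.log (Real.log (θ * r))) ≤ (r / t) * |c| := by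
    gcongr
    linarith [le_abs_self c, one_le_log_log hx]
  have h3 : (r / t) * |c| ≤ (1 / θ) * |c| := by gcongr
  have h4 : (1 / θ) * |c| = |c| / θ := by ring
  linarith

/-- The bound in the range `(log t) / 2 ≤ log (θ r)`. -/
lemma F_le_of_le_log {ρ θ c t r : ℝ} (hρ : 0 < ρ) (hθ : 0 < θ) (ht : 1 < t)
    (hl : 0 < Real.log (Real.log t)) (hr : 0 < r)
    (hκ : 0 < 1 - (Real.log 2 + c) / Real.log (Real.log t))
    (hlog : Real.log t / 2 ≤ Real.log (θ * r)) :
    ρ * Real.log (θ * r) - (r / t) * (Real.log (Real.log (θ * r)) - c)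
      ≤ ρ * Real.log (θ * (ρ * t / Real.log (Real.log t))) - ρ
        - ρ * Real.log (1 - (Real.log 2 + c) / Real.log (Real.log t)) := by
  have ht0 : 0 < t := by linarith
  have hu : 0 < Real.log t := Real.log_pos ht
  set l := Real.log (Real.log t) with hl_def
  have hll : l - Real.log 2 ≤ Real.log (Real.log (θ * r)) := by
    rw [hl_def, ← Real.log_div hu.ne' (by norm_num)]
    exact Real.log_le_log (by positivity) hlog
  have hR : 0 < ρ * t / l := by positivity
  have hy : 0 < r / (ρ * t / l) := by positivity
  have hmax := mul_le_mul_of_nonneg_left (log_add_one_sub_mul_le hy hκ) hρ.le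
  have hlogy : Real.log (θ * r) = Real.log (θ * (ρ * t / l)) + Real.log (r / (ρ * t / l)) := by
    rw [← Real.log_mul (by positivity) hy.ne']
    congr 1
    field_simp
  have hlin : ρ * (r / (ρ * t / l) * (1 - (Real.log 2 + c) / l))
      = (r / t) * (l - Real.log 2 - c) := by
    field_simp
    ring
  have hmono : (r / t) * (l - Real.log 2 - c) ≤ (r / t) * (Real.log (Real.log (θ * r)) - c) := by
    gcongr
  rw [hlogy] at hmono ⊢
  linarith

/-- with `F_{c,t}(r) = ρ log(θ r) − (r/t)(log(log(θ r)) − c)` for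
`r > 0` with `θ r ≥ e^e`, and `𝔯_t = ρ t / log(log t)`, one has
`limsup_{t→∞} [ sup_r F_{c,t}(r) − ρ log(θ 𝔯_t) + ρ ] ≤ 0`. -/
theorem sup_F_asymptotics (ρ θ c : ℝ) (hρ : 0 < ρ) (hθ : 0 < θ) :
    limsup (fun t : ℝ =>
        sSup { F : ℝ | ∃ r : ℝ, 0 < r ∧ Real.exp (Real.exp 1) ≤ θ * r ∧
            F = ρ * Real.log (θ * r) - (r / t) * (Real.log (Real.log (θ * r)) - c) }
          - ρ * Real.log (θ * (ρ * t / Real.log (Real.log t))) + ρ)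
      atTop ≤ 0 := by
  refine limsup_nonpos_of_forall_pos fun ε hε => ?_
  have hlog := Real.tendsto_log_atTop
  have hll : Tendsto (fun t : ℝ => Real.log (Real.log t)) atTop atTop := hlog.comp hlog
  have hκ : Tendsto (fun t : ℝ => 1 - (Real.log 2 + c) / Real.log (Real.log t)) atTop (nhds 1) := by
    simpa using (hll.const_div_atTop (Real.log 2 + c)).const_sub 1
  have hκlog : Tendsto (fun t : ℝ =>
      -(ρ * Real.log (1 - (Real.log 2 + c) / Real.log (Real.log t)))) atTop (nhds 0) := by
    simpa using ((hκ.log one_ne_zero).const_mul ρ).neg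
  filter_upwards [eventually_gt_atTop 1, hlog.eventually_gt_atTop 1, hll.eventually_gt_atTop 0,
    hκ.eventually_const_lt one_pos, hκlog.eventually_le_const hε,
    hlog.eventually_ge_atTop (4 * (Real.log 4 + 1 + |c| / θ / ρ - Real.log (θ * ρ)))]
    with t ht hu hl hκt hκε hK
  have ht0 : 0 < t := by linarith
  suffices h : sSup { F : ℝ | ∃ r : ℝ, 0 < r ∧ Real.exp (Real.exp 1) ≤ θ * r ∧
      F = ρ * Real.log (θ * r) - (r / t) * (Real.log (Real.log (θ * r)) - c) }
      ≤ ρ * Real.log (θ * (ρ * t / Real.log (Real.log t))) - ρ + ε by linarith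
  refine csSup_le ⟨_, Real.exp (Real.exp 1) / θ, by positivity, ?_, rfl⟩ ?_
  · rw [mul_div_cancel₀ _ hθ.ne']
  rintro _ ⟨r, hr, hx, rfl⟩
  rcases le_total (Real.log (θ * r)) (Real.log t / 2) with h | h
  · refine (F_le_of_log_le hρ hθ ht hr hx h).trans ?_
    have hsplit : Real.log (θ * (ρ * t / Real.log (Real.log t)))
        = Real.log (θ * ρ) + Real.log t - Real.log (Real.log (Real.log t)) := by
      rw [← Real.log_mul (by positivity) ht0.ne', ← Real.log_div (by positivity) hl.ne']
      congr 1
      ring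
    have hc : |c| / θ = ρ * (|c| / θ / ρ) := by field_simp
    have hmain : Real.log t / 2 + |c| / θ / ρ
        ≤ Real.log (θ * (ρ * t / Real.log (Real.log t))) - 1 := by
      rw [hsplit]
      linarith [log_log_le_div_four_add hu]
    have := mul_le_mul_of_nonneg_left hmain hρ.le
    linarith
  · linarith [F_le_of_le_log hρ hθ ht hl hr hκt h]
end
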